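/- arXiv:1909.08448 — 3 statements merged into one kernel-verified Lean document; each statement's English description precedes it below -/
import Mathlib

section
/- Let d ≥ 1 and let y = (y_I), indexed by the nonempty subsets I ⊆ [d], be a vector of real numbers such that for every 2-element subset E ⊆ [d] and every T with E ⊆ T ⊆ [d] one has Σ_{I : E ⊆ I ⊆ T} y_I ≥ 0. Then Σ_{I} y_I · h_{|I|−1} ≥ 0, where h_m = 1 + 1/2 + ⋯ + 1/m denotes the m-th harmonic number (h_0 = 0). (Equivalently, ℰ(P) ≥ 0 for every generalized permutahedron P, where ℰ is the Minkowski linear functional with ℰ(Δ_I) = h_{|I|−1}.) -/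
open Finset

/-- The `m`-th harmonic number `h_m = 1 + 1/2 + ⋯ + 1/m` (with `h_0 = 0`). -/
noncomputable def harm (m : ℕ) : ℝ := ∑ i ∈ Finset.Icc 1 m, (1 : ℝ) / i

/-- Iterated differences `(1 - shift)^n f`. -/
noncomputable def iterDiff (f : ℕ → ℝ) : ℕ → ℕ → ℝ
  | 0, k => f k
  | n + 1, k => iterDiff f n k - iterDiff f n (k + 1)

theorem harm_succ (m : ℕ) : harm (m + 1) = harm m + 1 / ((m : ℝ) + 1) := by
  unfold harm
  rw [Finset.sum_Icc_succ_top (by omega)]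
  push_cast
  rfl

theorem harm_mono : Monotone harm :=
  monotone_nat_of_le_succ fun n => by
    rw [harm_succ]
    have : (0 : ℝ) ≤ 1 / ((n : ℝ) + 1) := by positivity
    linarith

theorem iterDiff_harm_div (n k : ℕ) :
    iterDiff (fun k => harm (k + 1) / ((k : ℝ) + 1)) n k =
      (n.factorial * k.factorial : ℝ) / (k + n + 1).factorial *
        (harm (k + n + 1) - harm n) := by
  induction n generalizing k with
  | zero =>
    have h0 : harm 0 = 0 := by simp [harm]
    simp only [iterDiff, Nat.factorial_zero, add_zero, Nat.factorial_succ, h0]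
    push_cast
    field_simp
    ring
  | succ n ih =>
    have e1 : k + 1 + n + 1 = (k + n + 1) + 1 := by ring
    have e2 : k + (n + 1) + 1 = (k + n + 1) + 1 := by ring
    have hf : ((k + n + 1).factorial : ℝ) ≠ 0 := by positivity
    simp only [iterDiff, ih, e1, e2]
    rw [harm_succ (k + n + 1), harm_succ n, Nat.factorial_succ (k + n + 1),
      Nat.factorial_succ n, Nat.factorial_succ k]
    push_cast
    field_simp
    ring

theorem iterDiff_harm_div_nonneg (n k : ℕ) :
    0 ≤ iterDiff (fun k => harm (k + 1) / ((k : ℝ) + 1)) n k := by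
  rw [iterDiff_harm_div]
  exact mul_nonneg (by positivity) (sub_nonneg.2 (harm_mono (by omega)))

theorem iterDiff_div_succ (f : ℕ → ℝ) (n k : ℕ) :
    ((k : ℝ) + 2) * iterDiff (fun k => f k / ((k : ℝ) + 2)) (n + 1) k =
      iterDiff f (n + 1) k + (n + 1) * iterDiff (fun k => f k / ((k : ℝ) + 2)) n (k + 1) := by
  induction n generalizing k with
  | zero =>
    simp only [iterDiff]
    push_cast
    have : (k : ℝ) + 1 + 2 ≠ 0 := by positivity
    field_simp
    ring
  | succ n ih =>
    have h1 := ih k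
    have h2 := ih (k + 1)
    rw [iterDiff, iterDiff.eq_2 f k (n + 1), mul_sub, h1]
    have h3 := iterDiff.eq_2 (fun k => f k / ((k : ℝ) + 2)) (k + 1) n
    push_cast at h2 ⊢
    linear_combination -h2 - (n + 1) * h3

theorem iterDiff_div_nonneg {f : ℕ → ℝ} (hf : ∀ n k, 0 ≤ iterDiff f n k) (n k : ℕ) :
    0 ≤ iterDiff (fun k => f k / ((k : ℝ) + 2)) n k := by
  induction n generalizing k with
  | zero => exact div_nonneg (hf 0 k) (by positivity)
  | succ n ih =>
    refine nonneg_of_mul_nonneg_right (a := (k : ℝ) + 2) ?_ (by positivity)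
    rw [iterDiff_div_succ]
    exact add_nonneg (hf _ _) (mul_nonneg (by positivity) (ih _))

theorem sum_powerset_iterDiff {α : Type*} [DecidableEq α] (f : ℕ → ℝ) (S : Finset α) (n k : ℕ) :
    ∑ J ∈ S.powerset, iterDiff f (n + (S.card - J.card)) (k + J.card) = iterDiff f n k := by
  induction S using Finset.induction_on with
  | empty => simp
  | insert a S ha ih =>
    rw [Finset.sum_powerset_insert ha, ← ih, ← Finset.sum_add_distrib]
    refine Finset.sum_congr rfl fun J hJ => ?_
    have hJS := Finset.mem_powerset.1 hJ
    have hc := Finset.card_le_card hJS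
    rw [Finset.card_insert_of_notMem ha, Finset.card_insert_of_notMem fun h => ha (hJS h)]
    have e1 : n + (S.card + 1 - J.card) = n + (S.card - J.card) + 1 := by omega
    have e2 : n + (S.card + 1 - (J.card + 1)) = n + (S.card - J.card) := by omega
    rw [e1, e2, iterDiff, ← add_assoc]
    ring

theorem sum_superset_iterDiff {d : ℕ} (f : ℕ → ℝ) (I : Finset (Fin d)) (hI : 2 ≤ I.card) :
    ∑ T ∈ univ.filter (fun T => I ⊆ T), iterDiff f (d - T.card) (T.card - 2) =
      f (I.card - 2) := by
  have h := sum_powerset_iterDiff f Iᶜ 0 (I.card - 2)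
  rw [iterDiff] at h
  rw [← h]
  refine Finset.sum_nbij' (fun T => T \ I) (fun J => I ∪ J) ?_ ?_ ?_ ?_ ?_
  · intro T _
    simp only [mem_powerset]
    intro x
    simp
  · simp
  · intro T hT
    simpa using hT
  · intro J hJ
    have hJ := mem_powerset.1 hJ
    ext x
    have := @hJ x
    simp only [mem_compl] at this
    simp only [mem_sdiff, mem_union]
    tauto
  · intro T hT
    have hT : I ⊆ T := by simpa using hT
    have h1 := Finset.card_sdiff_add_card_eq_card hT
    have h2 := Finset.card_le_univ T
    rw [Fintype.card_fin] at h2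
    rw [Finset.card_compl, Fintype.card_fin]
    congr 1 <;> omega

theorem harm_eq_sum_pairs_supersets {d : ℕ} (I : Finset (Fin d)) (hI : I.Nonempty) :
    harm (I.card - 1) =
      ∑ _E ∈ univ.filter (fun E : Finset (Fin d) => E.card = 2 ∧ E ⊆ I),
        ∑ T ∈ univ.filter (fun T => I ⊆ T),
          2 * iterDiff (fun k => harm (k + 1) / ((k : ℝ) + 1) / ((k : ℝ) + 2))
            (d - T.card) (T.card - 2) := by
  have hE : univ.filter (fun E : Finset (Fin d) => E.card = 2 ∧ E ⊆ I) = I.powersetCard 2 := by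
    ext E
    simp [mem_powersetCard, and_comm]
  have hpos := hI.card_pos
  rw [hE, Finset.sum_const, Finset.card_powersetCard]
  rcases Nat.lt_or_ge I.card 2 with h | h
  · have h1 : I.card = 1 := by omega
    simp [h1, harm]
  · rw [← Finset.mul_sum, sum_superset_iterDiff _ I h]
    obtain ⟨k, hk⟩ := Nat.exists_eq_add_of_le h
    have e1 : I.card - 1 = k + 1 := by omega
    have e2 : I.card - 2 = k := by omega
    rw [e1, e2, hk, nsmul_eq_mul, Nat.cast_choose_two]
    push_cast
    have : (2 + (k : ℝ) - 1) = k + 1 := by ring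
    rw [this]
    field_simp
    ring

theorem stmt8 (d : ℕ) (hd : 1 ≤ d) (y : Finset (Fin d) → ℝ)
    (hy : ∀ E T : Finset (Fin d), E.card = 2 → E ⊆ T →
      0 ≤ ∑ I ∈ univ.filter (fun I : Finset (Fin d) => E ⊆ I ∧ I ⊆ T), y I) :
    0 ≤ ∑ I ∈ univ.filter (fun I : Finset (Fin d) => I.Nonempty),
        y I * harm (I.card - 1) := by
  set w : Finset (Fin d) → ℝ := fun T =>
    2 * iterDiff (fun k => harm (k + 1) / ((k : ℝ) + 1) / ((k : ℝ) + 2))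
      (d - T.card) (T.card - 2)
  have hw0 (T) : 0 ≤ w T :=
    mul_nonneg zero_le_two (iterDiff_div_nonneg iterDiff_harm_div_nonneg _ _)
  have key : ∑ I ∈ univ.filter (fun I : Finset (Fin d) => I.Nonempty), y I * harm (I.card - 1) =
      ∑ E ∈ univ.filter (fun E : Finset (Fin d) => E.card = 2),
        ∑ T ∈ univ.filter (fun T => E ⊆ T),
          ∑ I ∈ univ.filter (fun I : Finset (Fin d) => E ⊆ I ∧ I ⊆ T), y I * w T := by
    have step : ∀ I ∈ univ.filter (fun I : Finset (Fin d) => I.Nonempty),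
        y I * harm (I.card - 1) =
          ∑ E ∈ univ.filter (fun E : Finset (Fin d) => E.card = 2 ∧ E ⊆ I),
            ∑ T ∈ univ.filter (fun T => I ⊆ T), y I * w T := by
      intro I hI
      rw [harm_eq_sum_pairs_supersets I (by simpa using hI), Finset.mul_sum]
      simp_rw [Finset.mul_sum]
      rfl
    rw [Finset.sum_congr rfl step, Finset.sum_comm' (t' := univ.filter fun E => E.card = 2)
      (s' := fun E => univ.filter fun I => E ⊆ I)]
    · refine Finset.sum_congr rfl fun E _ => Finset.sum_comm' fun I T => ?_
      simp only [mem_filter, mem_univ, true_and]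
      exact ⟨fun h => ⟨h, h.1.trans h.2⟩, fun h => h.1⟩
    · intro I E
      simp only [mem_filter, mem_univ, true_and]
      refine ⟨fun h => ⟨h.2.2, h.2.1⟩, fun h => ⟨?_, h.2, h.1⟩⟩
      exact (Finset.card_pos.1 (by omega : 0 < E.card)).mono h.1
  rw [key]
  refine Finset.sum_nonneg fun E hE => Finset.sum_nonneg fun T hT => ?_
  rw [← Finset.sum_mul]
  exact mul_nonneg (hy E T (by simpa using hE) (by simpa using hT)) (hw0 T)
end

section
/- Let d ≥ 1 and let y = (y_I), indexed by the nonempty subsets I ⊆ [d], be a vector of integers such that for every 2-element subset E ⊆ [d] and every T with E ⊆ T ⊆ [d], Σ_{I : E ⊆ I ⊆ T} y_I ≥ 0. Let P ⊆ ℝ^d be the generalized permutahedron satisfying P + Σ_{I : y_I<0}(−y_I)·Δ_I = Σ_{I : y_I≥0} y_I·Δ_I, and let p be a polynomial such that p(n) = |nP ∩ ℤ^d| for all positive integers n. Then the linear coefficient of p equals Σ_I y_I · h_{|I|−1}, where h_m = 1 + 1/2 + ⋯ + 1/m (h_0 = 0). -/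
open Finset Pointwise

/-- The standard simplex `Δ_I ⊆ ℝ^d`: the convex hull of `{e_i : i ∈ I}`. -/
def stdSimp (d : ℕ) (I : Finset (Fin d)) : Set (Fin d → ℝ) :=
  convexHull ℝ ((fun i => (Pi.single i 1 : Fin d → ℝ)) '' (I : Set (Fin d)))

/-- The permutahedron `Π_d`: the convex hull of the points `(σ(1),…,σ(d))`. -/
def permutahedron (d : ℕ) : Set (Fin d → ℝ) :=
  convexHull ℝ {x | ∃ σ : Equiv.Perm (Fin d), x = fun i => ((σ i : ℕ) + 1 : ℝ)}

/-- A polytope is the convex hull of a finite set of points. -/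
def IsPolytope {d : ℕ} (P : Set (Fin d → ℝ)) : Prop :=
  ∃ S : Finset (Fin d → ℝ), P = convexHull ℝ (S : Set (Fin d → ℝ))

/-- A generalized permutahedron: a polytope `P` such that `P + Q = λ • Π_d`
for some polytope `Q` and some `λ > 0`. -/
def IsGenPerm {d : ℕ} (P : Set (Fin d → ℝ)) : Prop :=
  IsPolytope P ∧ ∃ lam : ℝ, 0 < lam ∧ ∃ Q : Set (Fin d → ℝ), IsPolytope Q ∧
    P + Q = lam • permutahedron d

/-- The lattice `ℤ^d` inside `ℝ^d`. -/
def latticePts (d : ℕ) : Set (Fin d → ℝ) := {x | ∀ i, ∃ m : ℤ, x i = (m : ℝ)}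

/-- The alternating count of chains of a family with a join-absorbing element vanishes. -/
theorem sum_chains_eq_zero {α : Type*} [DecidableEq α] (A : Finset (Finset α))
    (S₀ : Finset α) (h₀ : S₀ ∈ A) (hU : ∀ S ∈ A, S₀ ∪ S ∈ A) :
    ∑ C ∈ A.powerset with ∀ S ∈ C, ∀ T ∈ C, S ⊆ T ∨ T ⊆ S, (-1 : ℤ) ^ #C = 0 := by
  classical
  set U : Finset (Finset α) → Finset α := fun C => S₀ ∪ (C.filter (¬ S₀ ⊆ ·)).sup id with hUdef
  have hsub (C) : S₀ ⊆ U C := subset_union_left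
  have hUA (C : Finset (Finset α)) (hCA : C ⊆ A) (hC : ∀ S ∈ C, ∀ T ∈ C, S ⊆ T ∨ T ⊆ S) :
      U C ∈ A := by
    rcases (C.filter (¬ S₀ ⊆ ·)).eq_empty_or_nonempty with h | h
    · simp [hUdef, h, h₀]
    · obtain ⟨M, hM, hmax⟩ := Finset.exists_max_image _ Finset.card h
      have : (C.filter (¬ S₀ ⊆ ·)).sup id = M := by
        apply le_antisymm
        · apply Finset.sup_le
          intro c hc
          rcases hC _ (mem_filter.1 hc).1 _ (mem_filter.1 hM).1 with h1 | h1
          · exact h1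
          · exact (Finset.eq_of_subset_of_card_le h1 (hmax c hc)).symm.subset
        · exact Finset.le_sup (f := id) hM
      simp only [hUdef, this]
      exact hU _ (hCA (mem_filter.1 hM).1)
  have hins (C) : U (insert (U C) C) = U C := by
    have : (insert (U C) C).filter (¬ S₀ ⊆ ·) = C.filter (¬ S₀ ⊆ ·) := by
      rw [filter_insert, if_neg (by simpa using hsub C)]
    simp only [hUdef] at this ⊢
    rw [this]
  have hera (C) : U (C.erase (U C)) = U C := by
    have : (C.erase (U C)).filter (¬ S₀ ⊆ ·) = C.filter (¬ S₀ ⊆ ·) := by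
      rw [filter_erase, erase_eq_of_notMem]
      simp [hsub C]
    simp only [hUdef] at this ⊢
    rw [this]
  have hcomp (C : Finset (Finset α)) (hC : ∀ S ∈ C, ∀ T ∈ C, S ⊆ T ∨ T ⊆ S) :
      ∀ c ∈ C, c ⊆ U C ∨ U C ⊆ c := by
    intro c hc
    by_cases h : S₀ ⊆ c
    · right
      apply union_subset h
      apply Finset.sup_le
      intro c' hc'
      rcases hC _ (mem_filter.1 hc').1 _ hc with h1 | h1
      · exact h1
      · exact absurd (h.trans h1) (mem_filter.1 hc').2
    · left
      exact (Finset.le_sup (f := id) (mem_filter.2 ⟨hc, h⟩)).trans subset_union_right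
  refine Finset.sum_involution
    (fun C _ => if U C ∈ C then C.erase (U C) else insert (U C) C) ?_ ?_ ?_ ?_
  · intro C hC
    split_ifs with h
    · rw [card_erase_of_mem h]
      obtain ⟨k, hk⟩ : ∃ k, #C = k + 1 := ⟨#C - 1, by have := card_pos.2 ⟨_, h⟩; omega⟩
      rw [hk]; simp [pow_succ]
    · rw [card_insert_of_notMem h]; simp [pow_succ]
  · intro C hC _
    split_ifs with h
    · exact fun e => erase_ne_self.2 h e
    · exact fun e => h (insert_eq_self.1 e)
  · intro C hC
    obtain ⟨hCA, hCc⟩ := mem_filter.1 hC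
    rw [mem_powerset] at hCA
    split_ifs with h
    · refine mem_filter.2 ⟨mem_powerset.2 ((erase_subset _ _).trans hCA), ?_⟩
      exact fun S hS T hT => hCc S (mem_of_mem_erase hS) T (mem_of_mem_erase hT)
    · refine mem_filter.2 ⟨mem_powerset.2 (insert_subset (hUA C hCA hCc) hCA), ?_⟩
      intro S hS T hT
      rcases mem_insert.1 hS with rfl | hS <;> rcases mem_insert.1 hT with rfl | hT
      · exact Or.inl subset_rfl
      · exact (hcomp C hCc T hT).symm
      · exact hcomp C hCc S hS
      · exact hCc S hS T hT
  · intro C hC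
    by_cases h : U C ∈ C
    · simp only [h, if_true, hera, notMem_erase, if_false, insert_erase]
    · simp only [h, if_false, hins, mem_insert_self, if_true]
      exact erase_insert h

/-- The set of the entries of `σ` in positions up to `i`. -/
def prefixSet {n : ℕ} (σ : Equiv.Perm (Fin n)) (i : Fin n) : Finset (Fin n) :=
  univ.filter fun a => σ.symm a ≤ i

theorem mem_prefixSet {n : ℕ} {σ : Equiv.Perm (Fin n)} {i a : Fin n} :
    a ∈ prefixSet σ i ↔ σ.symm a ≤ i := by simp [prefixSet]

theorem apply_mem_prefixSet {n : ℕ} {σ : Equiv.Perm (Fin n)} {i j : Fin n} :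
    σ j ∈ prefixSet σ i ↔ j ≤ i := by simp [prefixSet]

theorem prefixSet_mono {n : ℕ} (σ : Equiv.Perm (Fin n)) : Monotone (prefixSet σ) :=
  fun _ _ h _ ha => mem_prefixSet.2 ((mem_prefixSet.1 ha).trans h)

theorem prefixSet_injective {n : ℕ} (σ : Equiv.Perm (Fin n)) :
    Function.Injective (prefixSet σ) := by
  intro i j h
  apply le_antisymm
  · rw [← apply_mem_prefixSet (σ := σ), ← h, apply_mem_prefixSet]
  · rw [← apply_mem_prefixSet (σ := σ), h, apply_mem_prefixSet]

theorem prefixSet_last {m : ℕ} (σ : Equiv.Perm (Fin (m + 1))) :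
    prefixSet σ (Fin.last m) = univ := by
  ext a; simp [mem_prefixSet, Fin.le_last]

theorem lt_of_forall_castSucc_lt_succ {m : ℕ} (f : Fin (m + 1) → Fin (m + 1)) {i j : Fin (m + 1)}
    (hij : i < j) (h : ∀ l : Fin m, i ≤ l.castSucc → l.castSucc < j → f l.castSucc < f l.succ) :
    f i < f j := by
  induction j using Fin.induction with
  | zero => exact absurd hij (Fin.not_lt_zero i)
  | succ l ih =>
    have hil : i ≤ l.castSucc := Fin.le_castSucc_iff.2 hij
    have h1 := h l hil Fin.castSucc_lt_succ
    rcases hil.eq_or_lt with e | hlt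
    · rw [e]; exact h1
    · exact (ih hlt fun k hk hk' => h k hk (hk'.trans Fin.castSucc_lt_succ)).trans h1

/-- Expanding over the positions where a set of the family is used, permutations with ascents
elsewhere are the stable refinements of chains. -/
theorem sum_perm_eq_sum_chains {m : ℕ} (A : Finset (Finset (Fin (m + 1)))) (hempty : ∅ ∉ A)
    (huniv : univ ∉ A) :
    ∑ σ : Equiv.Perm (Fin (m + 1)), ∏ j : Fin m,
      ((if σ j.castSucc < σ j.succ then (1 : ℤ) else 0) -
        (if prefixSet σ j.castSucc ∈ A then 1 else 0)) =
    ∑ C ∈ A.powerset with ∀ S ∈ C, ∀ T ∈ C, S ⊆ T ∨ T ⊆ S, (-1 : ℤ) ^ #C := by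
  classical
  have hexp (σ : Equiv.Perm (Fin (m + 1))) : ∏ j : Fin m,
      ((if σ j.castSucc < σ j.succ then (1 : ℤ) else 0) -
        (if prefixSet σ j.castSucc ∈ A then 1 else 0)) =
      ∑ J : Finset (Fin m) with ((∀ j ∈ J, prefixSet σ j.castSucc ∈ A) ∧
        ∀ j ∉ J, σ j.castSucc < σ j.succ), (-1 : ℤ) ^ #J := by
    simp only [sub_eq_neg_add]
    rw [Finset.prod_add, sum_filter]
    refine sum_congr rfl fun J _ => ?_
    rw [Finset.prod_neg, Finset.prod_ite_zero, Finset.prod_ite_zero]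
    simp only [prod_const_one, mem_sdiff, mem_univ, true_and]
    split_ifs <;> simp_all
  simp_rw [hexp]
  rw [Finset.sum_sigma']
  have hchain (σ : Equiv.Perm (Fin (m + 1))) (J : Finset (Fin m)) :
      ∀ S ∈ J.image fun j => prefixSet σ j.castSucc, ∀ T ∈ J.image fun j => prefixSet σ j.castSucc,
        S ⊆ T ∨ T ⊆ S := by
    intro S hS T hT
    obtain ⟨i, _, rfl⟩ := mem_image.1 hS
    obtain ⟨j, _, rfl⟩ := mem_image.1 hT
    rcases le_total i j with h | h
    · exact Or.inl (prefixSet_mono σ (Fin.castSucc_le_castSucc_iff.2 h))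
    · exact Or.inr (prefixSet_mono σ (Fin.castSucc_le_castSucc_iff.2 h))
  have hinjS (σ : Equiv.Perm (Fin (m + 1))) :
      Function.Injective fun j : Fin m => prefixSet σ j.castSucc :=
    (prefixSet_injective σ).comp (Fin.castSucc_injective m)
  have hsort (σ : Equiv.Perm (Fin (m + 1))) (J : Finset (Fin m))
      (hJ : ∀ j ∉ J, σ j.castSucc < σ j.succ) :
      σ = Tuple.sort fun a => #((J.image fun j => prefixSet σ j.castSucc).filter (a ∉ ·)) := by
    have hsub {i j : Fin (m + 1)} (hij : i ≤ j) :
        (J.image fun j => prefixSet σ j.castSucc).filter (σ i ∉ ·) ⊆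
          (J.image fun j => prefixSet σ j.castSucc).filter (σ j ∉ ·) := by
      refine monotone_filter_right _ fun S hS h => ?_
      obtain ⟨l, _, rfl⟩ := mem_image.1 hS
      rw [apply_mem_prefixSet] at h ⊢
      exact fun h' => h (hij.trans h')
    refine Tuple.eq_sort_iff.2 ⟨fun i j hij => card_le_card (hsub hij), fun i j hij h => ?_⟩
    have heq := eq_of_subset_of_card_le (hsub hij.le) h.ge
    refine lt_of_forall_castSucc_lt_succ σ hij fun l hl hl' => hJ l fun hlJ => ?_
    have hmem : prefixSet σ l.castSucc ∈
        (J.image fun j => prefixSet σ j.castSucc).filter (σ j ∉ ·) :=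
      mem_filter.2 ⟨mem_image_of_mem _ hlJ, by rw [apply_mem_prefixSet]; exact not_le.2 hl'⟩
    rw [← heq] at hmem
    exact (mem_filter.1 hmem).2 (apply_mem_prefixSet.2 hl)
  refine Finset.sum_bij (fun x _ => x.2.image fun j => prefixSet x.1 j.castSucc) ?_ ?_ ?_ ?_
  · rintro ⟨σ, J⟩ h
    simp only [mem_sigma, mem_filter] at h
    refine mem_filter.2 ⟨mem_powerset.2 ?_, hchain σ J⟩
    intro S hS
    obtain ⟨j, hj, rfl⟩ := mem_image.1 hS
    exact h.2.2.1 j hj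
  · rintro ⟨σ, J⟩ h ⟨τ, K⟩ h' e
    simp only [mem_sigma, mem_filter] at h h'
    dsimp only at e
    have h1 : σ = τ := by
      rw [hsort σ J h.2.2.2, hsort τ K h'.2.2.2, e]
    subst h1
    rw [(image_injective (hinjS σ)) e]
  · intro C hC
    obtain ⟨hCA, hCc⟩ := mem_filter.1 hC
    rw [mem_powerset] at hCA
    set f : Fin (m + 1) → ℕ := fun a => #(C.filter (a ∉ ·)) with hf
    set σ := Tuple.sort f with hσ
    obtain ⟨hmono, htie⟩ := Tuple.eq_sort_iff.1 hσ
    have hpre : ∀ S ∈ C, ∃ j : Fin m, prefixSet σ j.castSucc = S := by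
      intro S hS
      have hdown {i j : Fin (m + 1)} (hij : i ≤ j) (hj : σ j ∈ S) : σ i ∈ S := by
        by_contra hi
        refine (hmono hij).not_gt (card_lt_card ?_)
        refine ⟨fun T hT => ?_, fun h => ?_⟩
        · obtain ⟨hTC, hT⟩ := mem_filter.1 hT
          refine mem_filter.2 ⟨hTC, fun hiT => ?_⟩
          rcases hCc T hTC S hS with h | h
          · exact hi (h hiT)
          · exact hT (h hj)
        · exact (mem_filter.1 (h (mem_filter.2 ⟨hS, hi⟩))).2 hj
      have hSne : S.Nonempty := nonempty_iff_ne_empty.2 fun h => hempty (h ▸ hCA hS)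
      obtain ⟨k, hk, hkmax⟩ := exists_max_image S σ.symm hSne
      have hkS : prefixSet σ (σ.symm k) = S := by
        ext a
        rw [mem_prefixSet]
        refine ⟨fun h => ?_, fun h => hkmax a h⟩
        have := hdown h (by simpa using hk)
        simpa using this
      induction hq : σ.symm k using Fin.lastCases with
      | last => rw [hq, prefixSet_last] at hkS; exact absurd (hkS ▸ hCA hS) huniv
      | cast j => exact ⟨j, hq ▸ hkS⟩
    refine ⟨⟨σ, univ.filter fun j => prefixSet σ j.castSucc ∈ C⟩, ?_, ?_⟩
    · simp only [mem_sigma, mem_filter, mem_univ, true_and]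
      refine ⟨fun j hj => hCA hj, fun j hj => ?_⟩
      apply htie _ _ Fin.castSucc_lt_succ
      simp only [hf]
      congr 1
      refine filter_congr fun S hS => ?_
      obtain ⟨i, rfl⟩ := hpre S hS
      have : i ≠ j := by rintro rfl; exact hj hS
      rw [apply_mem_prefixSet, apply_mem_prefixSet, Fin.castSucc_le_castSucc_iff,
        Fin.succ_le_castSucc_iff]
      rw [not_iff_not, le_iff_lt_or_eq]
      simp [this.symm]
    · ext S
      simp only [mem_image, mem_filter, mem_univ, true_and]
      constructor
      · rintro ⟨j, hj, rfl⟩; exact hj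
      · intro hS
        obtain ⟨j, rfl⟩ := hpre S hS
        exact ⟨j, hS, rfl⟩
  · rintro ⟨σ, J⟩ h
    rw [card_image_of_injective _ (hinjS σ)]

theorem sum_perm_eq_ite {m : ℕ} (f : Finset (Fin (m + 1)) → ℤ) (hempty : f ∅ = 0)
    (huniv : f univ = 0) (hsub : ∀ S T, f (S ∪ T) + f (S ∩ T) ≤ f S + f T) :
    ∑ σ : Equiv.Perm (Fin (m + 1)), ∏ j : Fin m,
      ((if σ j.castSucc < σ j.succ then (1 : ℤ) else 0) -
        (if f (prefixSet σ j.castSucc) < 0 then 1 else 0)) =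
    if ∀ S, 0 ≤ f S then 1 else 0 := by
  have h := sum_perm_eq_sum_chains (univ.filter fun S => f S < 0) (by simp [hempty])
    (by simp [huniv])
  simp only [mem_filter, mem_univ, true_and] at h
  rw [h]
  obtain ⟨S₀, -, hmin⟩ := exists_min_image (univ : Finset (Finset (Fin (m + 1)))) f univ_nonempty
  split_ifs with hpos
  · have : (univ.filter fun S => f S < 0) = ∅ := by
      ext S; simpa using hpos S
    rw [this]; simp [sum_filter]
  · push Not at hpos
    obtain ⟨S, hS⟩ := hpos
    have h2 := sum_chains_eq_zero (univ.filter fun S => f S < 0) S₀ ?_ fun T hT => ?_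
    · convert h2
    · simpa using (hmin S (mem_univ _)).trans_lt hS
    · simp only [mem_filter, mem_univ, true_and] at hT ⊢
      have h1 := hsub S₀ T
      have h2 := hmin (S₀ ∩ T) (mem_univ _)
      omega

theorem prefixSet_zero {m : ℕ} (σ : Equiv.Perm (Fin (m + 1))) : prefixSet σ 0 = {σ 0} := by
  ext a
  simp [mem_prefixSet, Equiv.symm_apply_eq]

theorem prefixSet_succ {m : ℕ} (σ : Equiv.Perm (Fin (m + 1))) (j : Fin m) :
    prefixSet σ j.succ = insert (σ j.succ) (prefixSet σ j.castSucc) := by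
  ext a
  obtain ⟨i, rfl⟩ := σ.surjective a
  rw [mem_insert, apply_mem_prefixSet, apply_mem_prefixSet, σ.injective.eq_iff,
    le_iff_eq_or_lt, Fin.le_castSucc_iff]

theorem sum_prefixSet_zero {R : Type*} [AddCommMonoid R] {m : ℕ} (σ : Equiv.Perm (Fin (m + 1)))
    (x : Fin (m + 1) → R) : ∑ a ∈ prefixSet σ 0, x a = x (σ 0) := by
  rw [prefixSet_zero, sum_singleton]

theorem sum_prefixSet_succ {R : Type*} [AddCommMonoid R] {m : ℕ} (σ : Equiv.Perm (Fin (m + 1)))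
    (x : Fin (m + 1) → R) (j : Fin m) :
    ∑ a ∈ prefixSet σ j.succ, x a = x (σ j.succ) + ∑ a ∈ prefixSet σ j.castSucc, x a := by
  rw [prefixSet_succ, sum_insert]
  rw [apply_mem_prefixSet, not_le]
  exact Fin.castSucc_lt_succ

theorem sum_mul_eq_abel {R : Type*} [CommRing R] (m : ℕ) (w y X : Fin (m + 1) → R)
    (h0 : X 0 = y 0) (hs : ∀ j : Fin m, X j.succ = y j.succ + X j.castSucc) :
    ∑ i, w i * y i =
      ∑ j : Fin m, (w j.castSucc - w j.succ) * X j.castSucc + w (Fin.last m) * X (Fin.last m) := by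
  induction m with
  | zero => simp [h0]
  | succ m ih =>
    rw [Fin.sum_univ_castSucc, ih (fun i => w i.castSucc) (fun i => y i.castSucc)
      (fun i => X i.castSucc) (by simpa using h0) (fun j => by simpa using hs j.castSucc),
      Fin.sum_univ_castSucc (n := m)]
    have := hs (Fin.last m)
    simp only [Fin.succ_last, Fin.succ_castSucc] at this ⊢
    rw [this]
    ring

/-- Summation by parts along a permutation. -/
theorem sum_mul_eq_sum_prefixSet {R : Type*} [CommRing R] {m : ℕ} (σ : Equiv.Perm (Fin (m + 1)))
    (u x : Fin (m + 1) → R) :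
    ∑ a, u a * x a = ∑ j : Fin m, (u (σ j.castSucc) - u (σ j.succ)) *
      ∑ a ∈ prefixSet σ j.castSucc, x a + u (σ (Fin.last m)) * ∑ a, x a := by
  rw [← Equiv.sum_comp σ, sum_mul_eq_abel m (fun i => u (σ i)) (fun i => x (σ i))
    (fun i => ∑ a ∈ prefixSet σ i, x a) (sum_prefixSet_zero σ x) (sum_prefixSet_succ σ x),
    prefixSet_last]

/-- Integer vectors are determined by their partial sums along a permutation. -/
def prefixSumEquiv {m : ℕ} (σ : Equiv.Perm (Fin (m + 1))) :
    (Fin (m + 1) → ℤ) ≃ (Fin (m + 1) → ℤ) where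
  toFun x i := ∑ a ∈ prefixSet σ i, x a
  invFun b a := Fin.cases (motive := fun _ => ℤ) (b 0) (fun j => b j.succ - b j.castSucc) (σ.symm a)
  left_inv x := by
    ext a
    obtain ⟨i, rfl⟩ := σ.surjective a
    dsimp only
    rw [Equiv.symm_apply_apply]
    induction i using Fin.cases with
    | zero => rw [Fin.cases_zero, sum_prefixSet_zero]
    | succ j => rw [Fin.cases_succ, sum_prefixSet_succ, add_sub_cancel_right]
  right_inv b := by
    ext i
    dsimp only
    induction i using Fin.induction with
    | zero => rw [sum_prefixSet_zero, Equiv.symm_apply_apply, Fin.cases_zero]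
    | succ j ih =>
      rw [sum_prefixSet_succ, ih, Equiv.symm_apply_apply, Fin.cases_succ, sub_add_cancel]

theorem hasSum_mul_real {α β : Type*} {f : α → ℝ} {g : β → ℝ} {s t : ℝ} (hf : HasSum f s)
    (hg : HasSum g t) : HasSum (fun x : α × β => f x.1 * g x.2) (s * t) :=
  HasSum.mul hf hg (summable_mul_of_summable_norm hf.summable.abs hg.summable.abs)

theorem hasSum_pi_prod {n : ℕ} (g : Fin n → ℤ → ℝ) (s : Fin n → ℝ)
    (h : ∀ i, HasSum (g i) (s i)) :
    HasSum (fun b : Fin n → ℤ => ∏ i, g i (b i)) (∏ i, s i) := by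
  induction n with
  | zero => simp
  | succ n ih =>
    have h1 := ih (fun i => g i.succ) (fun i => s i.succ) fun i => h i.succ
    rw [← (Fin.consEquiv fun _ => ℤ).hasSum_iff, Fin.prod_univ_succ]
    have := hasSum_mul_real (h 0) h1
    refine this.congr_fun fun x => ?_
    rw [Function.comp_apply, Fin.prod_univ_succ]
    rfl

theorem hasSum_geometric_halfline {t : ℝ} (ht : 0 < t) {k : ℤ} (hk : k ≠ 0) :
    HasSum (fun a : ℤ => (((if 0 < k then 1 else 0) - (if a < 0 then 1 else 0) : ℤ) : ℝ) *
      Real.exp (-t * (k * a))) (1 - Real.exp (-t * k))⁻¹ := by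
  rcases hk.lt_or_gt with hk | hk
  · have hk' : (k : ℝ) < 0 := by exact_mod_cast hk
    have hlt : Real.exp (t * k) < 1 := Real.exp_lt_one_iff.2 (by nlinarith)
    have hg := (hasSum_geometric_of_lt_one (Real.exp_pos (t * k)).le hlt).mul_left
      (-Real.exp (t * k))
    have key := HasSum.of_nat_of_neg_add_one (f := fun a : ℤ =>
      (((if 0 < k then 1 else 0) - (if a < 0 then 1 else 0) : ℤ) : ℝ) * Real.exp (-t * (k * a)))
      (m := 0) (m' := -Real.exp (t * k) * (1 - Real.exp (t * k))⁻¹)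
      (by
        convert (hasSum_zero : HasSum (fun _ : ℕ => (0 : ℝ)) 0) using 2 with n
        simp [hk.not_gt])
      (by
        refine hg.congr_fun fun n => ?_
        rw [if_neg hk.not_gt, if_pos (by omega), ← Real.exp_nat_mul]
        push_cast
        rw [neg_mul (Real.exp (t * k)), ← Real.exp_add]
        ring_nf)
    convert key using 1
    rw [zero_add, neg_mul, Real.exp_neg]
    have h0 := Real.exp_pos (t * k)
    have h1 : 1 - Real.exp (t * k) ≠ 0 := by linarith
    have h2 : Real.exp (t * k) - 1 ≠ 0 := by linarith
    field_simp
    ring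
  · have hk' : (0 : ℝ) < k := by exact_mod_cast hk
    have hlt : Real.exp (-t * k) < 1 := Real.exp_lt_one_iff.2 (by nlinarith)
    have hg := hasSum_geometric_of_lt_one (Real.exp_pos (-t * k)).le hlt
    have key := HasSum.of_nat_of_neg_add_one (f := fun a : ℤ =>
      (((if 0 < k then 1 else 0) - (if a < 0 then 1 else 0) : ℤ) : ℝ) * Real.exp (-t * (k * a)))
      (m := (1 - Real.exp (-t * k))⁻¹) (m' := 0)
      (by
        convert hg using 2 with n
        rw [if_pos hk, if_neg (by omega), ← Real.exp_nat_mul]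
        push_cast
        rw [one_mul]
        ring_nf)
      (by
        convert (hasSum_zero : HasSum (fun _ : ℕ => (0 : ℝ)) 0) using 2 with n
        rw [if_pos hk, if_pos (by omega)]
        simp)
    simpa using key

/-- The exponent attached to the vertex of the base polytope of `z` given by `σ`. -/
def vertexWeight {m : ℕ} (σ : Equiv.Perm (Fin (m + 1))) (z : Finset (Fin (m + 1)) → ℤ) : ℤ :=
  ∑ j : Fin m, (((σ j.succ : ℕ) : ℤ) - ((σ j.castSucc : ℕ) : ℤ)) * z (prefixSet σ j.castSucc) -
    ((σ (Fin.last m) : ℕ) : ℤ) * z univ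

/-- The linear functional used to separate the lattice points. -/
def latticeWeight {m : ℕ} (x : Fin (m + 1) → ℤ) : ℤ := ∑ a : Fin (m + 1), -((a : ℕ) : ℤ) * x a

theorem latticeWeight_eq {m : ℕ} (σ : Equiv.Perm (Fin (m + 1))) (x : Fin (m + 1) → ℤ) :
    latticeWeight x = ∑ j : Fin m, (((σ j.succ : ℕ) : ℤ) - ((σ j.castSucc : ℕ) : ℤ)) *
      ∑ a ∈ prefixSet σ j.castSucc, x a - ((σ (Fin.last m) : ℕ) : ℤ) * ∑ a, x a := by
  rw [latticeWeight, sum_mul_eq_sum_prefixSet σ (fun a => -((a : ℕ) : ℤ))]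
  congr 1
  · refine sum_congr rfl fun j _ => ?_
    ring
  · ring

theorem hasSum_cone {m : ℕ} (σ : Equiv.Perm (Fin (m + 1))) (z : Finset (Fin (m + 1)) → ℤ)
    {t : ℝ} (ht : 0 < t) :
    HasSum (fun x : Fin (m + 1) → ℤ =>
      (((∏ j : Fin m, ((if σ j.castSucc < σ j.succ then (1 : ℤ) else 0) -
        (if ∑ a ∈ prefixSet σ j.castSucc, x a - z (prefixSet σ j.castSucc) < 0 then 1 else 0))) *
        (if ∑ a, x a = z univ then 1 else 0) : ℤ) : ℝ) * Real.exp (-t * latticeWeight x))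
      (Real.exp (-t * vertexWeight σ z) * ∏ j : Fin m,
        (1 - Real.exp (-t * (((σ j.succ : ℕ) : ℤ) - ((σ j.castSucc : ℕ) : ℤ) : ℤ)))⁻¹) := by
  set k : Fin m → ℤ := fun j => ((σ j.succ : ℕ) : ℤ) - ((σ j.castSucc : ℕ) : ℤ) with hk
  have hk0 (j : Fin m) : k j ≠ 0 := by
    have : σ j.succ ≠ σ j.castSucc := fun h => (Fin.castSucc_lt_succ (i := j)).ne' (σ.injective h)
    have : (σ j.succ : ℕ) ≠ σ j.castSucc := fun h => this (Fin.ext h)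
    simp only [hk]; omega
  have hkpos (j : Fin m) : σ j.castSucc < σ j.succ ↔ 0 < k j := by
    simp only [hk, Fin.lt_def]; omega
  let g : Fin (m + 1) → ℤ → ℝ := Fin.snoc (α := fun _ => ℤ → ℝ)
    (fun j a => (((if 0 < k j then 1 else 0) - (if a < 0 then 1 else 0) : ℤ) : ℝ) *
      Real.exp (-t * (k j * a))) (fun a => if a = 0 then 1 else 0)
  let s : Fin (m + 1) → ℝ := Fin.snoc (α := fun _ => ℝ)
    (fun j => (1 - Real.exp (-t * k j))⁻¹) 1
  have hgs : ∀ i, HasSum (g i) (s i) := by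
    intro i
    induction i using Fin.lastCases with
    | last => simpa [g, s] using hasSum_ite_eq (0 : ℤ) (1 : ℝ)
    | cast j => simpa [g, s] using hasSum_geometric_halfline ht (hk0 j)
  have h := (hasSum_pi_prod g s hgs).mul_left (Real.exp (-t * vertexWeight σ z))
  rw [← ((prefixSumEquiv σ).trans (Equiv.subRight fun i => z (prefixSet σ i))).hasSum_iff] at h
  have hs : ∏ i, s i = ∏ j : Fin m, (1 - Real.exp (-t * k j))⁻¹ := by
    simp [Fin.prod_univ_castSucc, s]
  rw [hs] at h
  refine h.congr_fun fun x => ?_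
  simp only [Function.comp_apply, Equiv.trans_apply, Equiv.subRight_apply, Pi.sub_apply,
    Fin.prod_univ_castSucc, g, Fin.snoc_castSucc, Fin.snoc_last, prefixSumEquiv, Equiv.coe_fn_mk,
    prefixSet_last, sub_eq_zero, prod_mul_distrib, hkpos]
  split_ifs with hx
  · rw [← Real.exp_sum, mul_one, mul_one, mul_left_comm, ← Real.exp_add]
    push_cast
    congr 2
    rw [latticeWeight_eq σ, vertexWeight, hx, ← mul_sum, ← mul_add]
    push_cast
    simp only [hk]
    push_cast
    simp only [mul_sub, sum_sub_distrib]
    ring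
  · simp

/-- The generating function of the lattice points as a sum over the vertex cones. -/
theorem sum_exp_eq {m : ℕ} (z : Finset (Fin (m + 1)) → ℤ) (hempty : z ∅ = 0)
    (hsup : ∀ S T, z S + z T ≤ z (S ∪ T) + z (S ∩ T)) (F : Finset (Fin (m + 1) → ℤ))
    (hF : ∀ x, x ∈ F ↔ ∑ a, x a = z univ ∧ ∀ S, z S ≤ ∑ a ∈ S, x a) {t : ℝ} (ht : 0 < t) :
    ∑ x ∈ F, Real.exp (-t * latticeWeight x) =
      ∑ σ : Equiv.Perm (Fin (m + 1)), Real.exp (-t * vertexWeight σ z) * ∏ j : Fin m,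
        (1 - Real.exp (-t * (((σ j.succ : ℕ) : ℤ) - ((σ j.castSucc : ℕ) : ℤ) : ℤ)))⁻¹ := by
  classical
  have h1 := hasSum_sum fun σ (_ : σ ∈ (univ : Finset (Equiv.Perm (Fin (m + 1))))) =>
    hasSum_cone σ z ht
  refine HasSum.unique ?_ h1
  have h2 : HasSum (fun x => if x ∈ F then Real.exp (-t * latticeWeight x) else 0)
      (∑ x ∈ F, if x ∈ F then Real.exp (-t * latticeWeight x) else 0) :=
    hasSum_sum_of_ne_finset_zero fun x hx => if_neg hx
  rw [sum_congr rfl fun x hx => if_pos hx] at h2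
  refine h2.congr_fun fun x => ?_
  rw [← sum_mul, ← Int.cast_sum, ← sum_mul]
  by_cases hx : ∑ a, x a = z univ
  · rw [if_pos hx, mul_one, sum_perm_eq_ite (fun S => ∑ a ∈ S, x a - z S)]
    · simp only [sub_nonneg, hF, hx, true_and]
      split_ifs <;> simp
    · simp [hempty]
    · simp [hx]
    · intro S T
      have := hsup S T
      have h3 := sum_union_inter (s₁ := S) (s₂ := T) (f := x)
      linarith
  · simp [hx, hF]

section AnalyticInTheParameter

open Topology Filter

theorem exists_analyticAt_mul_inv (k : ℤ) (hk : k ≠ 0) :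
    ∃ H : ℝ → ℝ, AnalyticAt ℝ H 0 ∧ ∀ t ≠ 0, H t = t * (1 - Real.exp (-t * k))⁻¹ := by
  have han : AnalyticAt ℝ (fun t : ℝ => 1 - Real.exp (-t * k)) 0 := by fun_prop
  have hd : HasDerivAt (fun t : ℝ => 1 - Real.exp (-t * k)) (k : ℝ) 0 := by
    have h1 : HasDerivAt (fun t : ℝ => -t * k) (-1 * (k : ℝ)) 0 :=
      ((hasDerivAt_id (0 : ℝ)).neg).mul_const _
    simpa using (h1.exp).const_sub 1
  refine ⟨fun t => (dslope (fun s : ℝ => 1 - Real.exp (-s * k)) 0 t)⁻¹, ?_, ?_⟩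
  · obtain ⟨p, hp⟩ := han
    refine AnalyticAt.inv ⟨_, hp.has_fpower_series_dslope_fslope⟩ ?_
    rw [dslope_same, hd.deriv]
    exact_mod_cast hk
  · intro t ht
    simp [dslope_of_ne _ ht, slope_def_field, div_eq_mul_inv]

/-- The number of lattice points of the base polytope of `z` is a universal polynomial in the
vertex weights. -/
theorem exists_polynomial_card (m : ℕ) :
    ∃ Q : Equiv.Perm (Fin (m + 1)) → Polynomial ℝ, ∀ z : Finset (Fin (m + 1)) → ℤ, z ∅ = 0 →
      (∀ S T, z S + z T ≤ z (S ∪ T) + z (S ∩ T)) → ∀ F : Finset (Fin (m + 1) → ℤ),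
      (∀ x, x ∈ F ↔ ∑ a, x a = z univ ∧ ∀ S, z S ≤ ∑ a ∈ S, x a) →
      (#F : ℝ) = ∑ σ, (Q σ).eval (vertexWeight σ z : ℝ) := by
  have hk0 (σ : Equiv.Perm (Fin (m + 1))) (j : Fin m) :
      ((σ j.succ : ℕ) : ℤ) - ((σ j.castSucc : ℕ) : ℤ) ≠ 0 := by
    have : σ j.succ ≠ σ j.castSucc := fun h => (Fin.castSucc_lt_succ (i := j)).ne' (σ.injective h)
    have : (σ j.succ : ℕ) ≠ σ j.castSucc := fun h => this (Fin.ext h)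
    omega
  choose H hHan hHeq using fun σ j => exists_analyticAt_mul_inv _ (hk0 σ j)
  let G : Equiv.Perm (Fin (m + 1)) → ℝ → ℝ := fun σ t => ∏ j, H σ j t
  have hG (σ) : AnalyticAt ℝ (G σ) 0 := Finset.analyticAt_fun_prod _ fun j _ => hHan σ j
  refine ⟨fun σ => ∑ i ∈ range (m + 1), Polynomial.C (((m.factorial : ℝ))⁻¹ *
    (m.choose i * iteratedDeriv (m - i) (G σ) 0)) * (-Polynomial.X) ^ i, ?_⟩
  intro z hempty hsup F hF
  have han1 : AnalyticAt ℝ (fun t : ℝ => ∑ x ∈ F, Real.exp (-t * latticeWeight x)) 0 := by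
    fun_prop
  have han2 (σ) : AnalyticAt ℝ (fun t : ℝ => Real.exp (-(vertexWeight σ z : ℝ) * t)) 0 := by
    fun_prop
  have hanR : AnalyticAt ℝ (∑ σ, (fun t : ℝ => Real.exp (-(vertexWeight σ z : ℝ) * t)) * G σ) 0 :=
    Finset.analyticAt_sum _ fun σ _ => (han2 σ).mul (hG σ)
  have hanP : AnalyticAt ℝ (fun t : ℝ => t ^ m) 0 := by fun_prop
  have heq : (fun t : ℝ => t ^ m) * (fun t : ℝ => ∑ x ∈ F, Real.exp (-t * latticeWeight x))
      =ᶠ[𝓝 0] ∑ σ, (fun t : ℝ => Real.exp (-(vertexWeight σ z : ℝ) * t)) * G σ := by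
    refine (AnalyticAt.frequently_eq_iff_eventually_eq (hanP.mul han1) hanR).1 ?_
    have hfreq : ∃ᶠ t in 𝓝[>] (0 : ℝ), 0 < t :=
      (eventually_mem_nhdsWithin (a := (0 : ℝ)) (s := Set.Ioi 0)).frequently
    refine (hfreq.filter_mono (nhdsWithin_mono _ fun t ht => ne_of_gt ht)).mono fun t ht => ?_
    rw [Pi.mul_apply, sum_exp_eq z hempty hsup F hF ht, mul_sum, Finset.sum_apply]
    refine sum_congr rfl fun σ _ => ?_
    simp only [Pi.mul_apply, G, fun j => hHeq σ j t ht.ne', prod_mul_distrib, prod_const,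
      card_univ, Fintype.card_fin]
    rw [show -t * (vertexWeight σ z : ℝ) = -(vertexWeight σ z : ℝ) * t by ring]
    ring
  have hD := heq.iteratedDeriv_eq m
  rw [iteratedDeriv_mul hanP.contDiffAt han1.contDiffAt,
    iteratedDeriv_sum fun σ _ => ((han2 σ).mul (hG σ)).contDiffAt, sum_range_succ,
    sum_eq_zero] at hD
  · simp only [iteratedDeriv_pow, Nat.descFactorial_self, Nat.choose_self, Nat.cast_one, one_mul,
      Nat.sub_self, iteratedDeriv_zero, pow_zero, mul_one, neg_zero, zero_mul, Real.exp_zero,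
      sum_const, nsmul_eq_mul, zero_add] at hD
    have hm : (m.factorial : ℝ) ≠ 0 := by exact_mod_cast m.factorial_ne_zero
    rw [← mul_right_inj' hm, hD, mul_sum]
    refine sum_congr rfl fun σ _ => ?_
    rw [iteratedDeriv_mul (han2 σ).contDiffAt (hG σ).contDiffAt, Polynomial.eval_finsetSum, mul_sum]
    refine sum_congr rfl fun i _ => ?_
    rw [iteratedDeriv_exp_const_mul]
    simp
    field_simp
  · intro i hi
    have hi' : m - i ≠ 0 := Nat.sub_ne_zero_of_lt (mem_range.1 hi)
    simp [iteratedDeriv_pow, hi']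

theorem coeff_one_eq_of_card {m : ℕ} {Q : Equiv.Perm (Fin (m + 1)) → Polynomial ℝ}
    {p : Polynomial ℝ} {z : Finset (Fin (m + 1)) → ℤ}
    (h : ∀ n : ℕ, 0 < n →
      p.eval (n : ℝ) = ∑ σ, (Q σ).eval (vertexWeight σ (fun S => n * z S) : ℝ)) :
    p.coeff 1 = ∑ σ, (Q σ).coeff 1 * vertexWeight σ z := by
  have hw (n : ℕ) (σ) : vertexWeight σ (fun S => n * z S) = n * vertexWeight σ z := by
    simp only [vertexWeight, mul_sub, mul_sum]
    congr 1
    · exact sum_congr rfl fun j _ => by ring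
    · ring
  have hp : p = ∑ σ, (Q σ).comp (Polynomial.C (vertexWeight σ z : ℝ) * Polynomial.X) := by
    refine Polynomial.eq_of_infinite_eval_eq _ _ (Set.infinite_of_injective_forall_mem
      (f := fun n : ℕ => ((n + 1 : ℕ) : ℝ)) (fun a b hab => by simpa using hab) fun n => ?_)
    rw [Set.mem_ofPred_eq, h _ n.succ_pos, Polynomial.eval_finsetSum]
    refine sum_congr rfl fun σ _ => ?_
    rw [hw, Polynomial.eval_comp]
    congr 1
    simp [mul_comm]
  rw [hp, Polynomial.finsetSum_coeff]
  refine sum_congr rfl fun σ _ => ?_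
  rw [Polynomial.comp_C_mul_X_coeff, pow_one]

end AnalyticInTheParameter

theorem finite_lattice_points {d : ℕ} (z : Finset (Fin d) → ℤ) :
    {x : Fin d → ℤ | ∑ a, x a = z univ ∧ ∀ S, z S ≤ ∑ a ∈ S, x a}.Finite := by
  refine (Set.finite_Icc (fun a => z {a}) (fun a => z univ - z (univ.erase a))).subset ?_
  rintro x ⟨hx, hz⟩
  refine ⟨fun a => by simpa using hz {a}, fun a => ?_⟩
  have h1 := hz (univ.erase a)
  have h2 := add_sum_erase univ x (mem_univ a)
  dsimp only
  omega

/-- The minimum of `∑ a ∈ T, x a` over the virtual Minkowski sum `∑ y_I Δ_I`. -/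
def simplexSum {d : ℕ} (y : Finset (Fin d) → ℤ) (T : Finset (Fin d)) : ℤ :=
  ∑ I with I.Nonempty, y I * if I ⊆ T then 1 else 0

theorem simplexSum_supermodular {d : ℕ} (y : Finset (Fin d) → ℤ)
    (hy : ∀ E T : Finset (Fin d), E.card = 2 → E ⊆ T →
      0 ≤ ∑ I ∈ univ.filter (fun I : Finset (Fin d) => E ⊆ I ∧ I ⊆ T), y I)
    (S T : Finset (Fin d)) :
    simplexSum y S + simplexSum y T ≤ simplexSum y (S ∪ T) + simplexSum y (S ∩ T) := by
  have key : simplexSum y (S ∪ T) + simplexSum y (S ∩ T) - (simplexSum y S + simplexSum y T) =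
      ∑ I with I ⊆ S ∪ T ∧ ¬ I ⊆ S ∧ ¬ I ⊆ T, y I := by
    simp only [simplexSum]
    rw [← sum_add_distrib, ← sum_add_distrib, ← sum_sub_distrib, sum_filter, sum_filter]
    refine sum_congr rfl fun I _ => ?_
    have h1 : I ⊆ S ∩ T ↔ I ⊆ S ∧ I ⊆ T := subset_inter_iff
    have h2 : I ⊆ S → I ⊆ S ∪ T := fun h => h.trans subset_union_left
    have h3 : I ⊆ T → I ⊆ S ∪ T := fun h => h.trans subset_union_right
    have h4 : ¬ I ⊆ S → I.Nonempty := fun h => by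
      rw [nonempty_iff_ne_empty]; rintro rfl; exact h (empty_subset _)
    by_cases hS : I ⊆ S <;> by_cases hT : I ⊆ T <;> by_cases hU : I ⊆ S ∪ T <;> simp_all
  rw [← sub_nonneg, key, ← sum_fiberwise_of_maps_to (g := fun I => ((I \ T).max, (I \ S).max))
    fun I hI => mem_image_of_mem _ hI]
  refine sum_nonneg fun v hv => ?_
  obtain ⟨I₀, hI₀, rfl⟩ := mem_image.1 hv
  simp only [mem_filter, mem_univ, true_and] at hI₀
  obtain ⟨i, hi⟩ := max_of_nonempty (sdiff_nonempty.2 hI₀.2.2)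
  obtain ⟨j, hj⟩ := max_of_nonempty (sdiff_nonempty.2 hI₀.2.1)
  have hmax {A : Finset (Fin d)} {a : Fin d} : A.max = a ↔ a ∈ A ∧ ∀ b ∈ A, b ≤ a := by
    refine ⟨fun h => ⟨mem_of_max h, fun b hb => le_max_of_eq hb h⟩, fun h => ?_⟩
    exact le_antisymm (Finset.max_le fun b hb => WithBot.coe_le_coe.2 (h.2 b hb)) (le_max h.1)
  have hi' := hI₀.1 (mem_sdiff.1 (mem_of_max hi)).1
  have hj' := hI₀.1 (mem_sdiff.1 (mem_of_max hj)).1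
  have hiT := (mem_sdiff.1 (mem_of_max hi)).2
  have hjS := (mem_sdiff.1 (mem_of_max hj)).2
  have hiS : i ∈ S := (mem_union.1 hi').resolve_right hiT
  have hjT : j ∈ T := (mem_union.1 hj').resolve_left hjS
  have hij : i ≠ j := by rintro rfl; exact hjS hiS
  have h := hy {i, j} ((S ∪ T).filter fun a => (a ∉ T → a ≤ i) ∧ (a ∉ S → a ≤ j))
    (card_pair hij) (by
      intro a ha
      rcases mem_insert.1 ha with rfl | ha
      · simp [hiS]
      · rw [mem_singleton] at ha
        subst ha
        simp [hjT])
  rw [filter_filter]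
  refine h.trans_eq (sum_congr (filter_congr fun I _ => Iff.symm ?_) fun _ _ => rfl)
  simp only [Prod.mk.injEq, hi, hj, hmax, mem_sdiff,
    insert_subset_iff, singleton_subset_iff]
  constructor
  · rintro ⟨⟨hIU, -, -⟩, ⟨⟨hiI, -⟩, h1⟩, ⟨⟨hjI, -⟩, h2⟩⟩
    exact ⟨⟨hiI, hjI⟩, fun a ha => mem_filter.2
      ⟨hIU ha, fun haT => h1 a ⟨ha, haT⟩, fun haS => h2 a ⟨ha, haS⟩⟩⟩
  · rintro ⟨⟨hiI, hjI⟩, hIU⟩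
    exact ⟨⟨fun a ha => (mem_filter.1 (hIU ha)).1, fun h => hjS (h hjI), fun h => hiT (h hiI)⟩,
      ⟨⟨hiI, hiT⟩, fun b hb => (mem_filter.1 (hIU hb.1)).2.1 hb.2⟩,
      ⟨⟨hjI, hjS⟩, fun b hb => (mem_filter.1 (hIU hb.1)).2.2 hb.2⟩⟩

theorem le_of_mem_stdSimp {d : ℕ} {I : Finset (Fin d)} {u : Fin d → ℝ} {c : ℝ}
    (h : ∀ i ∈ I, c ≤ u i) {x : Fin d → ℝ} (hx : x ∈ stdSimp d I) : c ≤ ∑ a, u a * x a := by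
  have hlin : IsLinearMap ℝ fun x : Fin d → ℝ => ∑ a, u a * x a :=
    ⟨fun x y => by simp [mul_add, sum_add_distrib], fun r x => by
      simp only [Pi.smul_apply, smul_eq_mul, mul_sum]
      exact sum_congr rfl fun _ _ => by ring⟩
  have hsub : stdSimp d I ⊆ {x | c ≤ ∑ a, u a * x a} := by
    refine convexHull_min ?_ (convex_halfSpace_ge hlin c)
    rintro _ ⟨i, hi, rfl⟩
    simpa [Pi.single_apply] using h i hi
  exact hsub hx

theorem single_mem_stdSimp {d : ℕ} {I : Finset (Fin d)} {i : Fin d} (hi : i ∈ I) :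
    Pi.single i 1 ∈ stdSimp d I := subset_convexHull ℝ _ ⟨i, hi, rfl⟩

section SupportFunction

variable {d : ℕ} {u : Fin d → ℝ} {μ : Finset (Fin d) → ℝ} {s : Finset (Finset (Fin d))}
  {c : Finset (Fin d) → ℝ}

theorem le_of_mem_sum_smul_stdSimp (hμ : ∀ I, I.Nonempty → ∃ i ∈ I, u i = μ I ∧ ∀ j ∈ I, μ I ≤ u j)
    (hs : ∀ I ∈ s, I.Nonempty ∧ 0 ≤ c I) {x : Fin d → ℝ}
    (hx : x ∈ ∑ I ∈ s, c I • stdSimp d I) : ∑ I ∈ s, c I * μ I ≤ ∑ a, u a * x a := by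
  obtain ⟨g, hg, rfl⟩ := (Set.mem_finsetSum _ _ _).1 hx
  simp only [Finset.sum_apply, mul_sum]
  rw [sum_comm]
  refine sum_le_sum fun I hI => ?_
  obtain ⟨w, hw, hwg⟩ := hg hI
  obtain ⟨i, -, -, hmin⟩ := hμ I (hs I hI).1
  have := mul_le_mul_of_nonneg_left (le_of_mem_stdSimp hmin hw) (hs I hI).2
  rw [← hwg]
  refine this.trans_eq ?_
  rw [mul_sum]
  refine sum_congr rfl fun a _ => ?_
  simp only [Pi.smul_apply, smul_eq_mul]
  ring

theorem exists_mem_sum_smul_stdSimp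
    (hμ : ∀ I, I.Nonempty → ∃ i ∈ I, u i = μ I ∧ ∀ j ∈ I, μ I ≤ u j)
    (hs : ∀ I ∈ s, I.Nonempty ∧ 0 ≤ c I) :
    ∃ x ∈ ∑ I ∈ s, c I • stdSimp d I, ∑ a, u a * x a = ∑ I ∈ s, c I * μ I := by
  classical
  have hg (I : Finset (Fin d)) : ∃ w : Fin d → ℝ, I.Nonempty →
      w ∈ stdSimp d I ∧ ∑ a, u a * w a = μ I := by
    by_cases hI : I.Nonempty
    · obtain ⟨i, hi, hui, -⟩ := hμ I hI
      exact ⟨Pi.single i 1, fun _ => ⟨single_mem_stdSimp hi, by simp [Pi.single_apply, hui]⟩⟩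
    · exact ⟨0, fun h => absurd h hI⟩
  choose w hw using hg
  refine ⟨∑ I ∈ s, c I • w I, (Set.mem_finsetSum _ _ _).2
    ⟨fun I => c I • w I, fun {I} hI => Set.smul_mem_smul_set (hw I (hs I hI).1).1, rfl⟩, ?_⟩
  simp only [Finset.sum_apply, mul_sum]
  rw [sum_comm]
  refine sum_congr rfl fun I hI => ?_
  rw [← (hw I (hs I hI).1).2, mul_sum]
  refine sum_congr rfl fun a _ => ?_
  simp only [Pi.smul_apply, smul_eq_mul]
  ring

end SupportFunction

section WeakMinkowskiSummand

variable {d : ℕ} {y : Finset (Fin d) → ℤ} {P : Set (Fin d → ℝ)} {u : Fin d → ℝ}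
  {μ : Finset (Fin d) → ℝ}

theorem sum_nonneg_sub_sum_neg (y : Finset (Fin d) → ℤ) (μ : Finset (Fin d) → ℝ) :
    ∑ I with I.Nonempty ∧ 0 ≤ y I, ((y I : ℤ) : ℝ) * μ I -
      ∑ I with I.Nonempty ∧ y I < 0, ((-(y I) : ℤ) : ℝ) * μ I =
    ∑ I with I.Nonempty, (y I : ℝ) * μ I := by
  simp only [sum_filter, ← sum_sub_distrib]
  refine sum_congr rfl fun I _ => ?_
  by_cases hI : I.Nonempty <;> rcases lt_or_ge (y I) 0 with h | h <;>
    simp [hI, h, not_le_of_gt, not_lt_of_ge]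

theorem le_of_mem_of_add_eq
    (hPsum : P + (∑ I ∈ univ.filter (fun I : Finset (Fin d) => I.Nonempty ∧ y I < 0),
          ((-(y I) : ℤ) : ℝ) • stdSimp d I)
        = ∑ I ∈ univ.filter (fun I : Finset (Fin d) => I.Nonempty ∧ 0 ≤ y I),
            ((y I : ℤ) : ℝ) • stdSimp d I)
    (hμ : ∀ I, I.Nonempty → ∃ i ∈ I, u i = μ I ∧ ∀ j ∈ I, μ I ≤ u j)
    {x : Fin d → ℝ} (hx : x ∈ P) :
    ∑ I with I.Nonempty, (y I : ℝ) * μ I ≤ ∑ a, u a * x a := by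
  obtain ⟨v, hv, hvu⟩ := exists_mem_sum_smul_stdSimp (c := fun I => ((-(y I) : ℤ) : ℝ)) hμ
    (s := univ.filter fun I : Finset (Fin d) => I.Nonempty ∧ y I < 0) fun I hI => by
      simp only [mem_filter, mem_univ, true_and] at hI
      exact ⟨hI.1, by exact_mod_cast (by omega : 0 ≤ -y I)⟩
  have h := le_of_mem_sum_smul_stdSimp hμ (fun I hI => by
      simp only [mem_filter, mem_univ, true_and] at hI
      exact ⟨hI.1, by exact_mod_cast hI.2⟩) (hPsum ▸ Set.add_mem_add hx hv)
  rw [← sum_nonneg_sub_sum_neg]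
  simp only [Pi.add_apply, mul_add, sum_add_distrib, hvu] at h
  linarith

theorem exists_mem_le_of_add_eq
    (hPsum : P + (∑ I ∈ univ.filter (fun I : Finset (Fin d) => I.Nonempty ∧ y I < 0),
          ((-(y I) : ℤ) : ℝ) • stdSimp d I)
        = ∑ I ∈ univ.filter (fun I : Finset (Fin d) => I.Nonempty ∧ 0 ≤ y I),
            ((y I : ℤ) : ℝ) • stdSimp d I)
    (hμ : ∀ I, I.Nonempty → ∃ i ∈ I, u i = μ I ∧ ∀ j ∈ I, μ I ≤ u j) :
    ∃ x ∈ P, ∑ a, u a * x a ≤ ∑ I with I.Nonempty, (y I : ℝ) * μ I := by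
  obtain ⟨q, hq, hqu⟩ := exists_mem_sum_smul_stdSimp (c := fun I => ((y I : ℤ) : ℝ)) hμ
    (s := univ.filter fun I : Finset (Fin d) => I.Nonempty ∧ 0 ≤ y I) fun I hI => by
      simp only [mem_filter, mem_univ, true_and] at hI
      exact ⟨hI.1, by exact_mod_cast hI.2⟩
  rw [← hPsum] at hq
  obtain ⟨x, hx, v, hv, rfl⟩ := hq
  have h := le_of_mem_sum_smul_stdSimp hμ (fun I hI => by
      simp only [mem_filter, mem_univ, true_and] at hI
      exact ⟨hI.1, by exact_mod_cast (by omega : 0 ≤ -y I)⟩) hv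
  refine ⟨x, hx, ?_⟩
  rw [← sum_nonneg_sub_sum_neg]
  simp only [Pi.add_apply, mul_add, sum_add_distrib] at hqu
  linarith

end WeakMinkowskiSummand

theorem exists_perm_forall_subset_iff {m : ℕ} (u : Fin (m + 1) → ℝ) :
    ∃ σ : Equiv.Perm (Fin (m + 1)), (∀ j : Fin m, u (σ j.succ) ≤ u (σ j.castSucc)) ∧
      ∀ I : Finset (Fin (m + 1)), I.Nonempty → ∃ i ∈ I,
        u i = ∑ j : Fin m, (u (σ j.castSucc) - u (σ j.succ)) *
            (if I ⊆ prefixSet σ j.castSucc then 1 else 0) + u (σ (Fin.last m)) ∧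
          ∀ j ∈ I, u i ≤ u j := by
  have hmono := Tuple.monotone_sort fun a => -u a
  set σ := Tuple.sort fun a => -u a
  have hanti {a b : Fin (m + 1)} (h : a ≤ b) : u (σ b) ≤ u (σ a) := by
    simpa using hmono h
  refine ⟨σ, fun j => hanti (Fin.castSucc_le_succ j), fun I hI => ?_⟩
  obtain ⟨i, hi, hmax⟩ := exists_max_image I σ.symm hI
  refine ⟨i, hi, ?_, fun j hj => by simpa using hanti (hmax j hj)⟩
  have h := sum_mul_eq_sum_prefixSet σ u (Pi.single i 1)
  simp only [Pi.single_apply, mul_ite, mul_one, mul_zero, sum_ite_eq', mem_univ, if_true] at h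
  rw [h]
  congr 1
  refine sum_congr rfl fun j _ => ?_
  have hiff : I ⊆ prefixSet σ j.castSucc ↔ i ∈ prefixSet σ j.castSucc :=
    ⟨fun h => h hi, fun h a ha => mem_prefixSet.2 ((hmax a ha).trans (mem_prefixSet.1 h))⟩
  simp only [hiff, mul_ite, mul_one, mul_zero]

theorem mem_iff_of_add_eq {m : ℕ} {y : Finset (Fin (m + 1)) → ℤ} {P : Set (Fin (m + 1) → ℝ)}
    (hP : IsPolytope P)
    (hPsum : P + (∑ I ∈ univ.filter (fun I : Finset (Fin (m + 1)) => I.Nonempty ∧ y I < 0),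
          ((-(y I) : ℤ) : ℝ) • stdSimp (m + 1) I)
        = ∑ I ∈ univ.filter (fun I : Finset (Fin (m + 1)) => I.Nonempty ∧ 0 ≤ y I),
            ((y I : ℤ) : ℝ) • stdSimp (m + 1) I) (x : Fin (m + 1) → ℝ) :
    x ∈ P ↔ ∑ a, x a = simplexSum y univ ∧ ∀ T, (simplexSum y T : ℝ) ≤ ∑ a ∈ T, x a := by
  have hZ (T : Finset (Fin (m + 1))) : (simplexSum y T : ℝ) =
      ∑ I with I.Nonempty, (y I : ℝ) * if I ⊆ T then 1 else 0 := by
    simp [simplexSum]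
  constructor
  · intro hx
    have hlow (T : Finset (Fin (m + 1))) : (simplexSum y T : ℝ) ≤ ∑ a ∈ T, x a := by
      have h := le_of_mem_of_add_eq hPsum (u := fun a => if a ∈ T then 1 else 0)
        (μ := fun I => if I ⊆ T then 1 else 0) (fun I hI => ?_) hx
      · simpa [hZ] using h
      · by_cases hIT : I ⊆ T
        · obtain ⟨i, hi⟩ := hI
          exact ⟨i, hi, by simp [hIT, hIT hi], fun j hj => by simp [hIT, hIT hj]⟩
        · obtain ⟨i, hi, hiT⟩ := not_subset.1 hIT
          exact ⟨i, hi, by simp [hIT, hiT], fun j hj => by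
            simp only [hIT, if_false]; split_ifs <;> simp⟩
    refine ⟨le_antisymm ?_ (hlow univ), hlow⟩
    have h := le_of_mem_of_add_eq hPsum (u := fun _ => -1) (μ := fun _ => -1)
      (fun I ⟨i, hi⟩ => ⟨i, hi, rfl, fun _ _ => le_rfl⟩) hx
    simp only [mul_neg, mul_one, neg_mul, one_mul, sum_neg_distrib, neg_le_neg_iff] at h
    simpa [hZ] using h
  · rintro ⟨hsum, hx⟩
    by_contra hxP
    obtain ⟨S, rfl⟩ := hP
    obtain ⟨f, r, hfx, hfP⟩ := geometric_hahn_banach_point_closed (convex_convexHull ℝ _)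
      (S.finite_toSet.isClosed_convexHull ℝ) hxP
    have hf (v : Fin (m + 1) → ℝ) : f v = ∑ a, f (Pi.single a 1) * v a := by
      conv_lhs => rw [← univ_sum_single v, map_sum]
      refine sum_congr rfl fun a _ => ?_
      rw [mul_comm, ← smul_eq_mul, ← map_smul, ← Pi.single_smul, smul_eq_mul, mul_one]
    obtain ⟨σ, hσ, hmin⟩ := exists_perm_forall_subset_iff fun a => f (Pi.single a 1)
    obtain ⟨v, hv, hvle⟩ := exists_mem_le_of_add_eq hPsum
      (u := fun a => f (Pi.single a 1)) (μ := fun I => _) fun I hI => by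
        obtain ⟨i, hi, hiu, hle⟩ := hmin I hI
        exact ⟨i, hi, hiu, fun j hj => hiu ▸ hle j hj⟩
    have hle : f v ≤ f x := by
      rw [hf v, hf x]
      refine hvle.trans ?_
      rw [sum_mul_eq_sum_prefixSet σ, hsum]
      simp only [mul_add, sum_add_distrib, mul_sum]
      rw [sum_comm]
      refine add_le_add (sum_le_sum fun j _ => ?_) (le_of_eq ?_)
      · rw [← mul_sum]
        refine (le_of_eq ?_).trans
          (mul_le_mul_of_nonneg_left (hx (prefixSet σ j.castSucc)) (sub_nonneg.2 (hσ j)))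
        rw [hZ, mul_sum]
        exact sum_congr rfl fun I _ => by ring
      · rw [hZ, mul_sum]
        exact sum_congr rfl fun I _ => by simp [mul_comm]
    linarith [hfP v hv]

theorem card_dilate_simplex {d : ℕ} {I : Finset (Fin d)} (hI : I.Nonempty) (n : ℕ)
    {F : Finset (Fin d → ℤ)}
    (hF : ∀ x, x ∈ F ↔ ∑ a, x a = (n : ℤ) * (if I ⊆ univ then 1 else 0) ∧
      ∀ S, (n : ℤ) * (if I ⊆ S then 1 else 0) ≤ ∑ a ∈ S, x a) :
    #F = (n + (#I - 1)).choose (#I - 1) := by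
  have hI1 := hI.card_pos
  rw [show n + (#I - 1) = #I + n - 1 by omega, ← Nat.choose_symm (by omega),
    show #I + n - 1 - (#I - 1) = n by omega, ← card_finsuppAntidiag_nat_eq_choose]
  symm
  refine card_bij (fun f _ a => (f a : ℤ)) ?_ ?_ ?_
  · intro f hf
    obtain ⟨hsum, hsupp⟩ := mem_finsuppAntidiag.1 hf
    have hS {S : Finset (Fin d)} (hIS : I ⊆ S) : ∑ a ∈ S, (f a : ℤ) = n := by
      rw [← hsum, Nat.cast_sum]
      exact (sum_subset hIS fun a _ ha => by
        simpa using fun h => ha (hsupp (Finsupp.mem_support_iff.2 h))).symm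
    refine (hF _).2 ⟨by simp [hS (subset_univ I)], fun S => ?_⟩
    split_ifs with h
    · simp [hS h]
    · simpa using sum_nonneg fun a _ => Int.natCast_nonneg (f a)
  · intro f _ g _ h
    ext a
    exact_mod_cast congrFun h a
  · intro x hx
    obtain ⟨hsum, hx⟩ := (hF x).1 hx
    simp only [subset_univ, if_true, mul_one] at hsum
    have hnonneg (a : Fin d) : 0 ≤ x a := by
      have h := hx {a}
      rw [sum_singleton] at h
      refine le_trans ?_ h
      positivity
    have hzero {a : Fin d} (ha : a ∉ I) : x a = 0 := by
      have h := hx (univ.erase a)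
      rw [if_pos (subset_erase.2 ⟨subset_univ I, ha⟩)] at h
      have h2 := add_sum_erase univ x (mem_univ a)
      have := hnonneg a
      omega
    refine ⟨Finsupp.equivFunOnFinite.symm fun a => (x a).toNat, ?_, ?_⟩
    · refine mem_finsuppAntidiag.2 ⟨?_, fun a ha => ?_⟩
      · zify
        rw [← hsum, ← sum_subset (subset_univ I) fun a _ ha => hzero ha]
        exact sum_congr rfl fun a _ => by simp [hnonneg a]
      · by_contra h
        simp [hzero h] at ha
    · ext a
      simp [hnonneg a]

/-- The Ehrhart polynomial of the standard simplex of dimension `k`. -/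
noncomputable def simplexEhrhart (k : ℕ) : Polynomial ℝ :=
  ∏ i ∈ range k, (1 + Polynomial.C (1 / ((i : ℝ) + 1)) * Polynomial.X)

theorem simplexEhrhart_eval (k n : ℕ) :
    (simplexEhrhart k).eval (n : ℝ) = ((n + k).choose k : ℝ) := by
  induction k with
  | zero => simp [simplexEhrhart]
  | succ k ih =>
    rw [simplexEhrhart, prod_range_succ, Polynomial.eval_mul, ← simplexEhrhart, ih]
    have h : ((n + k + 1 : ℕ) : ℝ) * ((n + k).choose k : ℝ) =
        ((n + (k + 1)).choose (k + 1) : ℝ) * ((k + 1 : ℕ) : ℝ) := by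
      exact_mod_cast Nat.add_one_mul_choose_eq (n + k) k
    push_cast at h
    simp only [Polynomial.eval_add, Polynomial.eval_one, Polynomial.eval_mul, Polynomial.eval_C,
      Polynomial.eval_X]
    have hk : (k : ℝ) + 1 ≠ 0 := by positivity
    field_simp
    linarith

theorem simplexEhrhart_coeff (k : ℕ) :
    (simplexEhrhart k).coeff 0 = 1 ∧ (simplexEhrhart k).coeff 1 = harm k := by
  induction k with
  | zero => simp [simplexEhrhart, harm, Polynomial.coeff_one]
  | succ k ih =>
    rw [simplexEhrhart, prod_range_succ, ← simplexEhrhart]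
    simp [Polynomial.mul_coeff_zero, Polynomial.mul_coeff_one, ih, harm, Polynomial.coeff_one,
      sum_Icc_succ_top, add_comm]

theorem ncard_smul_inter_latticePts {d : ℕ} {P : Set (Fin d → ℝ)} {z : Finset (Fin d) → ℤ}
    (hP : ∀ x, x ∈ P ↔ ∑ a, x a = z univ ∧ ∀ T, (z T : ℝ) ≤ ∑ a ∈ T, x a) {n : ℕ} (hn : 0 < n)
    {F : Finset (Fin d → ℤ)}
    (hF : ∀ x, x ∈ F ↔ ∑ a, x a = n * z univ ∧ ∀ S, n * z S ≤ ∑ a ∈ S, x a) :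
    (((n : ℝ) • P) ∩ latticePts d).ncard = #F := by
  have hn' : (0 : ℝ) < n := by exact_mod_cast hn
  have hcast (x : Fin d → ℤ) : (fun a => (x a : ℝ)) ∈ (n : ℝ) • P ↔ x ∈ F := by
    rw [Set.mem_smul_set_iff_inv_smul_mem₀ hn'.ne', hP, hF]
    simp only [Pi.smul_apply, smul_eq_mul, ← mul_sum]
    refine and_congr ?_ (forall_congr' fun T => ?_)
    · rw [inv_mul_eq_iff_eq_mul₀ hn'.ne']
      exact_mod_cast Iff.rfl
    · rw [le_inv_mul_iff₀ hn']
      exact_mod_cast Iff.rfl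
  have himage : ((n : ℝ) • P) ∩ latticePts d =
      (fun x : Fin d → ℤ => fun a => (x a : ℝ)) '' (F : Set (Fin d → ℤ)) := by
    ext v
    constructor
    · rintro ⟨hv, hlat⟩
      choose x hx using hlat
      obtain rfl : v = fun a => (x a : ℝ) := funext hx
      exact ⟨x, (hcast x).1 hv, rfl⟩
    · rintro ⟨x, hx, rfl⟩
      exact ⟨(hcast x).2 hx, fun a => ⟨x a, rfl⟩⟩
  rw [himage, Set.ncard_image_of_injective _ fun x x' h => funext fun a => by
    exact_mod_cast congrFun h a, Set.ncard_coe_finset]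

theorem vertexWeight_simplexSum {m : ℕ} (σ : Equiv.Perm (Fin (m + 1)))
    (y : Finset (Fin (m + 1)) → ℤ) :
    vertexWeight σ (simplexSum y) =
      ∑ I with I.Nonempty, y I * vertexWeight σ fun S => if I ⊆ S then 1 else 0 := by
  simp only [vertexWeight, simplexSum, mul_sub, mul_sum, sum_sub_distrib]
  rw [sum_comm]
  congr 1
  · exact sum_congr rfl fun I _ => sum_congr rfl fun j _ => by ring
  · exact sum_congr rfl fun I _ => by ring

theorem dilate_supermodular {d : ℕ} {z : Finset (Fin d) → ℤ}
    (hz : ∀ S T, z S + z T ≤ z (S ∪ T) + z (S ∩ T)) (n : ℕ) (S T : Finset (Fin d)) :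
    n * z S + n * z T ≤ n * z (S ∪ T) + n * z (S ∩ T) := by
  rw [← mul_add, ← mul_add]
  exact mul_le_mul_of_nonneg_left (hz S T) (Int.natCast_nonneg n)

theorem indicator_supermodular {d : ℕ} (I S T : Finset (Fin d)) :
    (if I ⊆ S then 1 else 0 : ℤ) + (if I ⊆ T then 1 else 0) ≤
      (if I ⊆ S ∪ T then 1 else 0) + if I ⊆ S ∩ T then 1 else 0 := by
  have h1 : I ⊆ S ∩ T ↔ I ⊆ S ∧ I ⊆ T := subset_inter_iff
  have h2 : I ⊆ S → I ⊆ S ∪ T := fun h => h.trans subset_union_left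
  have h3 : I ⊆ T → I ⊆ S ∪ T := fun h => h.trans subset_union_right
  split_ifs <;> simp_all

theorem stmt9 (d : ℕ) (hd : 1 ≤ d) (y : Finset (Fin d) → ℤ)
    (hy : ∀ E T : Finset (Fin d), E.card = 2 → E ⊆ T →
      0 ≤ ∑ I ∈ univ.filter (fun I : Finset (Fin d) => E ⊆ I ∧ I ⊆ T), y I)
    (P : Set (Fin d → ℝ)) (hP : IsGenPerm P)
    (hPsum : P + (∑ I ∈ univ.filter (fun I : Finset (Fin d) => I.Nonempty ∧ y I < 0),
          ((-(y I) : ℤ) : ℝ) • stdSimp d I)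
        = ∑ I ∈ univ.filter (fun I : Finset (Fin d) => I.Nonempty ∧ 0 ≤ y I),
            ((y I : ℤ) : ℝ) • stdSimp d I)
    (p : Polynomial ℝ)
    (hp : ∀ n : ℕ, 0 < n → p.eval (n : ℝ) = ((((n : ℝ) • P) ∩ latticePts d).ncard : ℝ)) :
    p.coeff 1 = ∑ I ∈ univ.filter (fun I : Finset (Fin d) => I.Nonempty),
        ((y I : ℤ) : ℝ) * harm (I.card - 1) := by
  obtain ⟨m, rfl⟩ : ∃ m, d = m + 1 := ⟨d - 1, by omega⟩
  obtain ⟨Q, hQ⟩ := exists_polynomial_card m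
  have hcard {z : Finset (Fin (m + 1)) → ℤ} (hz : ∀ S T, z S + z T ≤ z (S ∪ T) + z (S ∩ T))
      (h0 : z ∅ = 0) (n : ℕ) {F : Finset (Fin (m + 1) → ℤ)}
      (hF : ∀ x, x ∈ F ↔ ∑ a, x a = n * z univ ∧ ∀ S, n * z S ≤ ∑ a ∈ S, x a) :
      (#F : ℝ) = ∑ σ, (Q σ).eval (vertexWeight σ (fun S => n * z S) : ℝ) :=
    hQ (fun S => n * z S) (by simp [h0]) (dilate_supermodular hz n) F hF
  have hfin (z : Finset (Fin (m + 1)) → ℤ) (n : ℕ) : ∃ F : Finset (Fin (m + 1) → ℤ),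
      ∀ x, x ∈ F ↔ ∑ a, x a = n * z univ ∧ ∀ S, n * z S ≤ ∑ a ∈ S, x a :=
    ⟨(finite_lattice_points fun S => n * z S).toFinset, fun x => by simp⟩
  have hharm (I : Finset (Fin (m + 1))) (hI : I.Nonempty) :
      harm (#I - 1) = ∑ σ, (Q σ).coeff 1 * vertexWeight σ fun S => if I ⊆ S then 1 else 0 := by
    rw [← (simplexEhrhart_coeff _).2]
    refine coeff_one_eq_of_card fun n _ => ?_
    obtain ⟨F, hF⟩ := hfin (fun S => if I ⊆ S then 1 else 0) n
    rw [simplexEhrhart_eval, ← card_dilate_simplex hI n hF]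
    exact hcard (indicator_supermodular I) (by simp [hI.ne_empty]) n hF
  have hp1 : p.coeff 1 = ∑ σ, (Q σ).coeff 1 * vertexWeight σ (simplexSum y) := by
    refine coeff_one_eq_of_card fun n hn => ?_
    obtain ⟨F, hF⟩ := hfin (simplexSum y) n
    rw [hp n hn, ncard_smul_inter_latticePts (mem_iff_of_add_eq hP.1 hPsum) hn hF]
    refine hcard (simplexSum_supermodular y hy) (sum_eq_zero fun I hI => ?_) n hF
    simp [(mem_filter.1 hI).2.ne_empty]
  rw [hp1]
  simp only [vertexWeight_simplexSum, Int.cast_sum, Int.cast_mul, mul_sum]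
  rw [sum_comm]
  refine sum_congr rfl fun I hI => ?_
  rw [hharm I (mem_filter.1 hI).2, mul_sum]
  exact sum_congr rfl fun σ _ => by ring
end

section
/- Let P ⊆ ℝ^d be a generalized permutahedron that is a lattice polytope (the convex hull of finitely many points of ℤ^d), and let p be a polynomial such that p(n) = |nP ∩ ℤ^d| for all positive integers n (the Ehrhart polynomial of P). Then the linear coefficient of p is nonnegative. -/
open Finset Pointwise

section LatticePoints

variable {α : Type} [DecidableEq α]

/-- The lattice points of the base polytope of `f` on the ground set `E`, extended by zero. -/
def basePts (E : Finset α) (f : Finset α → ℤ) : Set (α → ℤ) :=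
  {x | (∀ i, i ∉ E → x i = 0) ∧ (∀ T, T ⊆ E → ∑ i ∈ T, x i ≤ f T) ∧ ∑ i ∈ E, x i = f E}

/-- The points of `basePts E f` with no proper tight subset containing `k`. -/
def freePts (E : Finset α) (k : α) (f : Finset α → ℤ) : Set (α → ℤ) :=
  {x | x ∈ basePts E f ∧ ∀ T, T ⊂ E → k ∈ T → ∑ i ∈ T, x i ≠ f T}

/-- The contraction of a set function by `A`. -/
def contract (A : Finset α) (f : Finset α → ℤ) : Finset α → ℤ := fun T => f (A ∪ T) - f A

/-- Normalised submodular set functions. -/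
def Submod (f : Finset α → ℤ) : Prop :=
  f ∅ = 0 ∧ ∀ A B, f (A ∪ B) + f (A ∩ B) ≤ f A + f B

/-- The set function of the standard simplex on `S`. -/
def simplexFn (S : Finset α) : Finset α → ℤ := fun T => if (S ∩ T).Nonempty then 1 else 0

lemma Submod.contract {f : Finset α → ℤ} (hf : Submod f) (A : Finset α) :
    Submod (contract A f) := by
  refine ⟨by simp [_root_.contract], fun S T => ?_⟩
  have h := hf.2 (A ∪ S) (A ∪ T)
  rw [← Finset.union_union_distrib_left, ← Finset.union_inter_distrib_left] at h
  simp only [_root_.contract]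
  linarith

lemma Submod.add {f g : Finset α → ℤ} (hf : Submod f) (hg : Submod g) : Submod (f + g) := by
  refine ⟨by simp [hf.1, hg.1], fun S T => ?_⟩
  have h1 := hf.2 S T
  have h2 := hg.2 S T
  simp only [Pi.add_apply]
  linarith

lemma Submod.nsmul {f : Finset α → ℤ} (hf : Submod f) (n : ℕ) : Submod (n • f) := by
  induction n with
  | zero => exact ⟨by simp, by simp⟩
  | succ n ih => rw [succ_nsmul]; exact ih.add hf

lemma Submod.sum {ι : Type} {f : ι → Finset α → ℤ} (s : Finset ι) (hf : ∀ i, Submod (f i)) :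
    Submod (∑ i ∈ s, f i) := by
  classical
  induction s using Finset.induction_on with
  | empty => exact ⟨by simp, by simp⟩
  | insert a s ha ih => rw [Finset.sum_insert ha]; exact (hf a).add ih

lemma submod_simplexFn (S : Finset α) : Submod (simplexFn S) := by
  refine ⟨by simp [simplexFn], fun A B => ?_⟩
  have h1 : (S ∩ (A ∪ B)).Nonempty → (S ∩ A).Nonempty ∨ (S ∩ B).Nonempty := by
    rintro ⟨x, hx⟩
    simp only [Finset.mem_inter, Finset.mem_union] at hx
    rcases hx with ⟨h, h' | h'⟩
    · exact Or.inl ⟨x, by simp [h, h']⟩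
    · exact Or.inr ⟨x, by simp [h, h']⟩
  have h2 : (S ∩ (A ∩ B)).Nonempty → (S ∩ A).Nonempty ∧ (S ∩ B).Nonempty := by
    rintro ⟨x, hx⟩
    simp only [Finset.mem_inter] at hx
    exact ⟨⟨x, by simp [hx]⟩, ⟨x, by simp [hx]⟩⟩
  unfold simplexFn
  split_ifs <;> first | omega | tauto

lemma basePts_finite [Fintype α] (E : Finset α) (f : Finset α → ℤ) : (basePts E f).Finite := by
  refine (Set.finite_Icc (fun i => if i ∈ E then f E - f (E.erase i) else 0)
    (fun i => if i ∈ E then f {i} else 0)).subset ?_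
  rintro x ⟨h0, h1, h2⟩
  refine ⟨fun i => ?_, fun i => ?_⟩ <;> by_cases hi : i ∈ E
  · have := h1 _ (Finset.erase_subset i E)
    have h3 := Finset.add_sum_erase E x hi
    simp only [hi, if_true]
    linarith
  · simp [hi, h0 i hi]
  · have := h1 {i} (by simpa using hi)
    simpa [hi] using this
  · simp [hi, h0 i hi]

lemma basePts_congr {β : Type} {E : Finset β} {f g : Finset β → ℤ} (h : ∀ T, T ⊆ E → f T = g T) :
    basePts E f = basePts E g := by
  ext x
  simp only [basePts, Set.mem_ofPred_eq, h E (Finset.Subset.refl E)]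
  refine and_congr_right fun _ => and_congr_left fun _ => ?_
  exact forall_congr' fun T => forall_congr' fun hT => by rw [h T hT]

lemma tight_inter {E : Finset α} {f : Finset α → ℤ} (hf : Submod f) {x : α → ℤ}
    (hx : x ∈ basePts E f) {A B : Finset α} (hA : A ⊆ E) (hB : B ⊆ E)
    (h1 : ∑ i ∈ A, x i = f A) (h2 : ∑ i ∈ B, x i = f B) : ∑ i ∈ A ∩ B, x i = f (A ∩ B) := by
  have h3 := Finset.sum_union_inter (s₁ := A) (s₂ := B) (f := x)
  have h4 := hf.2 A B
  have h5 := hx.2.1 (A ∪ B) (Finset.union_subset hA hB)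
  have h6 := hx.2.1 (A ∩ B) (Finset.inter_subset_left.trans hA)
  linarith

/-- The points of `basePts E f` whose smallest tight set containing `k` is `T`. -/
def tightPts (E T : Finset α) (k : α) (f : Finset α → ℤ) : Set (α → ℤ) :=
  {x | x ∈ basePts E f ∧ ∑ i ∈ T, x i = f T ∧ ∀ U, U ⊂ T → k ∈ U → ∑ i ∈ U, x i ≠ f U}

lemma ncard_tightPts {E T : Finset α} (hT : T ⊆ E) (k : α) {f : Finset α → ℤ} (hf : Submod f) :
    (tightPts E T k f).ncard = (freePts T k f).ncard * (basePts (E \ T) (contract T f)).ncard := by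
  rw [← Set.ncard_prod]
  refine Set.ncard_congr
    (fun x _ => (fun i => if i ∈ T then x i else 0, fun i => if i ∈ T then 0 else x i)) ?_ ?_ ?_
  · rintro x ⟨⟨h0, h1, h2⟩, h3, h4⟩
    have hs : ∀ U, U ⊆ T → ∑ i ∈ U, (if i ∈ T then x i else 0) = ∑ i ∈ U, x i := fun U hU =>
      Finset.sum_congr rfl fun i hi => by simp [hU hi]
    have ht : ∀ U, U ⊆ E \ T →
        ∑ i ∈ U, (if i ∈ T then 0 else x i) = ∑ i ∈ T ∪ U, x i - f T := by
      intro U hU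
      rw [Finset.sum_union (Finset.disjoint_sdiff.mono_right hU), h3, add_sub_cancel_left]
      refine Finset.sum_congr rfl fun i hi => ?_
      simp [(Finset.mem_sdiff.1 (hU hi)).2]
    refine ⟨⟨⟨fun i hi => by simp [hi], fun U hU => ?_, ?_⟩, fun U hU hk => ?_⟩,
      ⟨fun i hi => ?_, fun U hU => ?_, ?_⟩⟩
    · simpa only [hs U hU] using h1 U (hU.trans hT)
    · simpa only [hs T subset_rfl] using h3
    · simpa only [hs U hU.1] using h4 U hU hk
    · by_cases hi' : i ∈ T
      · simp [hi']
      · simpa [hi'] using h0 i fun h => hi (by simp [h, hi'])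
    · simp only [ht U hU, contract]
      have := h1 (T ∪ U) (Finset.union_subset hT (hU.trans Finset.sdiff_subset))
      linarith
    · simp only [ht _ subset_rfl, contract]
      rw [Finset.union_sdiff_of_subset hT, h2]
  · rintro x y _ _ h
    simp only [Prod.mk.injEq] at h
    funext i
    by_cases hi : i ∈ T
    · simpa [hi] using congrFun h.1 i
    · simpa [hi] using congrFun h.2 i
  · rintro ⟨y, z⟩ ⟨⟨⟨y0, y1, y2⟩, y3⟩, ⟨z0, z1, z2⟩⟩
    simp only at y0 y1 y2 y3 z0 z1 z2
    have hs : ∀ U, U ⊆ T → ∑ i ∈ U, (y + z) i = ∑ i ∈ U, y i := fun U hU =>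
      Finset.sum_congr rfl fun i hi => by simp [z0 i fun h => (Finset.mem_sdiff.1 h).2 (hU hi)]
    have ht : ∀ U, U ⊆ E \ T → ∑ i ∈ U, (y + z) i = ∑ i ∈ U, z i := fun U hU =>
      Finset.sum_congr rfl fun i hi => by simp [y0 i (Finset.mem_sdiff.1 (hU hi)).2]
    have hst : ∀ U, U ⊆ E →
        ∑ i ∈ U, (y + z) i = ∑ i ∈ U ∩ T, y i + ∑ i ∈ U \ T, z i := by
      intro U hU
      rw [← hs _ Finset.inter_subset_right, ← ht _ (Finset.sdiff_subset_sdiff hU subset_rfl)]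
      exact (Finset.sum_inter_add_sum_sdiff U T _).symm
    refine ⟨y + z, ⟨⟨fun i hi => ?_, fun U hU => ?_, ?_⟩, ?_, fun U hU hk => ?_⟩, ?_⟩
    · simp [y0 i fun h => hi (hT h), z0 i fun h => hi (Finset.mem_sdiff.1 h).1]
    · rw [hst U hU]
      have h1 := y1 (U ∩ T) Finset.inter_subset_right
      have h2 := z1 (U \ T) (Finset.sdiff_subset_sdiff hU subset_rfl)
      have h3 := hf.2 T U
      simp only [contract, Finset.union_sdiff_self_eq_union] at h2
      rw [Finset.inter_comm T U] at h3
      linarith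
    · rw [hst E subset_rfl, Finset.inter_eq_right.2 hT, y2, z2, contract,
        Finset.union_sdiff_of_subset hT]
      ring
    · rw [hs T subset_rfl, y2]
    · rw [hs U hU.1]
      exact y3 U hU hk
    · refine Prod.ext ?_ ?_ <;> funext i <;> by_cases hi : i ∈ T
      · simp [hi, z0 i fun h => (Finset.mem_sdiff.1 h).2 hi]
      · simp [hi, y0 i hi]
      · simp [hi, z0 i fun h => (Finset.mem_sdiff.1 h).2 hi]
      · simp [hi, y0 i hi]

lemma ncard_exists_tight [Fintype α] {E S : Finset α} {k : α} {f : Finset α → ℤ} (hf : Submod f) :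
    {x | x ∈ basePts E f ∧ ∃ T, T ⊆ E \ S ∧ k ∈ T ∧ ∑ i ∈ T, x i = f T}.ncard =
      ∑ T ∈ (E \ S).powerset with k ∈ T,
        (freePts T k f).ncard * (basePts (E \ T) (contract T f)).ncard := by
  have hfin : ∀ T, (tightPts E T k f).Finite := fun T =>
    (basePts_finite E f).subset fun _ h => h.1
  have hmem : ∀ T, T ∈ (E \ S).powerset.filter (k ∈ ·) ↔ T ⊆ E \ S ∧ k ∈ T := by simp
  have hEq : {x | x ∈ basePts E f ∧ ∃ T, T ⊆ E \ S ∧ k ∈ T ∧ ∑ i ∈ T, x i = f T} =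
      ↑(((E \ S).powerset.filter (k ∈ ·)).biUnion fun T => (hfin T).toFinset) := by
    ext x
    simp only [Set.mem_ofPred_eq, Finset.coe_biUnion, Set.mem_iUnion, Finset.mem_coe,
      Set.Finite.coe_toFinset, hmem, exists_prop]
    constructor
    · rintro ⟨hx, T, hT⟩
      obtain ⟨U, hU, hmin⟩ := Finset.exists_min_image
        (((E \ S).powerset.filter (k ∈ ·)).filter fun T => ∑ i ∈ T, x i = f T) Finset.card
        ⟨T, by simp [hT.1, hT.2.1, hT.2.2]⟩
      simp only [Finset.mem_filter, Finset.mem_powerset] at hU hmin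
      refine ⟨U, hU.1, hx, hU.2, fun V hV hk h => ?_⟩
      exact absurd (hmin V ⟨⟨hV.1.trans hU.1.1, hk⟩, h⟩) (not_le.2 (Finset.card_lt_card hV))
    · rintro ⟨T, hT, hx⟩
      exact ⟨hx.1, T, hT.1, hT.2, hx.2.1⟩
  rw [hEq, Set.ncard_coe_finset, Finset.card_biUnion]
  · refine Finset.sum_congr rfl fun T hT => ?_
    rw [← Set.ncard_eq_toFinset_card _ (hfin T)]
    exact ncard_tightPts (((hmem T).1 hT).1.trans Finset.sdiff_subset) k hf
  · intro A hA B hB hAB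
    rw [Finset.mem_coe, hmem] at hA hB
    refine Finset.disjoint_left.2 fun x hxA hxB => hAB ?_
    rw [Set.Finite.mem_toFinset] at hxA hxB
    have h := tight_inter hf hxA.1 (hA.1.trans Finset.sdiff_subset)
      (hB.1.trans Finset.sdiff_subset) hxA.2.1 hxB.2.1
    have hk : k ∈ A ∩ B := by simp [hA.2, hB.2]
    have hA' : A ∩ B = A := by
      by_contra hne
      exact hxA.2.2 _ (Finset.inter_subset_left.ssubset_of_ne hne) hk h
    have hB' : A ∩ B = B := by
      by_contra hne
      exact hxB.2.2 _ (Finset.inter_subset_right.ssubset_of_ne hne) hk h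
    rw [← hA', hB']

lemma ncard_basePts [Fintype α] {E : Finset α} {k : α} (hk : k ∈ E) {f : Finset α → ℤ}
    (hf : Submod f) :
    (basePts E f).ncard = ∑ T ∈ E.powerset with k ∈ T,
        (freePts T k f).ncard * (basePts (E \ T) (contract T f)).ncard := by
  have h := ncard_exists_tight (E := E) (S := ∅) (k := k) hf
  rw [Finset.sdiff_empty] at h
  rw [← h]
  congr 1
  ext x
  exact ⟨fun hx => ⟨hx, E, subset_rfl, hk, hx.2.2⟩, fun hx => hx.1⟩

lemma sum_add_single (x : α → ℤ) (k : α) (T : Finset α) :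
    ∑ i ∈ T, (x + Pi.single k 1 : α → ℤ) i = ∑ i ∈ T, x i + if k ∈ T then 1 else 0 := by
  simp [Finset.sum_add_distrib, Pi.single_apply]

lemma ncard_basePts_add_simplexFn [Fintype α] {E S : Finset α} {k : α} (hS : S ⊆ E) (hk : k ∈ E)
    (hne : S.Nonempty) {f : Finset α → ℤ} (hf : Submod f) :
    (basePts E (f + simplexFn (insert k S))).ncard = (basePts E (f + simplexFn S)).ncard +
      ∑ T ∈ (E \ S).powerset with k ∈ T,
        (freePts T k f).ncard * (basePts (E \ T) (contract T f)).ncard := by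
  rw [← ncard_exists_tight hf]
  have hSE : simplexFn S E = 1 := by
    rw [simplexFn, if_pos]; rwa [Finset.inter_eq_left.2 hS]
  have hkE : simplexFn (insert k S) E = 1 := by
    rw [simplexFn, if_pos]; exact ⟨k, by simp [hk]⟩
  have hle : ∀ T, simplexFn S T ≤ simplexFn (insert k S) T := by
    intro T
    unfold simplexFn
    have : (S ∩ T).Nonempty → ((insert k S) ∩ T).Nonempty := fun h =>
      h.mono (Finset.inter_subset_inter_right (Finset.subset_insert k S))
    split_ifs <;> first | omega | tauto
  have hzero : ∀ T, S ∩ T = ∅ → simplexFn S T = 0 := fun T h => by simp [simplexFn, h]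
  have hsingle : ∀ T, (if k ∈ T then (1 : ℤ) else 0) ≤ simplexFn (insert k S) T := by
    intro T
    by_cases h : k ∈ T
    · rw [if_pos h, simplexFn, if_pos]; exact ⟨k, by simp [h]⟩
    · rw [if_neg h, simplexFn]; split_ifs <;> simp
  have hle1 : ∀ T, simplexFn (insert k S) T ≤ 1 := fun T => by
    unfold simplexFn; split_ifs <;> simp
  have hsub : basePts E (f + simplexFn S) ⊆ basePts E (f + simplexFn (insert k S)) := by
    rintro x ⟨h0, h1, h2⟩
    refine ⟨h0, fun T hT => (h1 T hT).trans ?_, ?_⟩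
    · simpa using hle T
    · rw [h2]; simp [hSE, hkE]
  rw [← Set.ncard_sdiff_add_ncard_of_subset hsub (basePts_finite _ _), add_comm]
  congr 1
  symm
  refine Set.ncard_congr (fun x _ => x + (Pi.single k 1 : α → ℤ)) ?_ ?_ ?_
  · rintro x ⟨⟨h0, h1, h2⟩, T, hT, hkT, hxT⟩
    refine ⟨⟨fun i hi => ?_, fun U hU => ?_, ?_⟩, fun h => ?_⟩
    · have : i ≠ k := fun h => hi (h ▸ hk)
      simp [h0 i hi, this]
    · rw [sum_add_single]
      exact add_le_add (h1 U hU) (hsingle U)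
    · rw [sum_add_single, h2, if_pos hk, Pi.add_apply, hkE]
    · have h3 := h.2.1 T (hT.trans Finset.sdiff_subset)
      rw [sum_add_single, if_pos hkT, hxT, Pi.add_apply, hzero] at h3
      · omega
      · exact Finset.disjoint_iff_inter_eq_empty.1 (Finset.disjoint_sdiff.mono_right hT)
  · rintro x y _ _ h
    exact add_right_cancel h
  · rintro p ⟨⟨h0, h1, h2⟩, hp⟩
    have hT : ∃ T, T ⊆ E ∧ f T + simplexFn S T < ∑ i ∈ T, p i := by
      by_contra! hcon
      exact hp ⟨h0, hcon, by rw [h2]; simp [hSE, hkE]⟩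
    obtain ⟨T, hTE, hT⟩ := hT
    have hT1 := h1 T hTE
    have hST : simplexFn S T < simplexFn (insert k S) T := by
      rw [Pi.add_apply] at hT1; linarith
    have hdis : S ∩ T = ∅ := by
      by_contra hcon
      have : simplexFn S T = 1 := by
        rw [simplexFn, if_pos (Finset.nonempty_iff_ne_empty.2 hcon)]
      have := hle1 T
      omega
    have hkT : k ∈ T := by
      by_contra hcon
      rw [hzero T hdis, simplexFn, if_neg] at hST
      · omega
      · rw [Finset.insert_inter_of_notMem hcon, hdis]; simp
    have hpT : ∑ i ∈ T, p i = f T + 1 := by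
      have := hle1 T
      rw [Pi.add_apply] at hT1
      rw [hzero T hdis] at hT
      omega
    refine ⟨p - Pi.single k 1, ⟨⟨fun i hi => ?_, fun U hU => ?_, ?_⟩, T, ?_, hkT, ?_⟩, by simp⟩
    · have : i ≠ k := fun h => hi (h ▸ hk)
      simp [h0 i hi, this]
    · have h3 := sum_add_single (p - Pi.single k 1) k U
      rw [sub_add_cancel] at h3
      have hU1 := h1 U hU
      rw [Pi.add_apply] at hU1
      have hU2 := hle1 U
      by_cases hkU : k ∈ U
      · rw [if_pos hkU] at h3
        omega
      · rw [if_neg hkU] at h3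
        by_contra! hcon
        have h4 := hf.2 U T
        have h5 := Finset.sum_union_inter (s₁ := U) (s₂ := T) (f := p)
        have h6 := h1 (U ∪ T) (Finset.union_subset hU hTE)
        have h7 := h1 (U ∩ T) (Finset.inter_subset_left.trans hU)
        have h8 := hle1 (U ∪ T)
        have h9 : simplexFn (insert k S) (U ∩ T) = 0 := by
          rw [simplexFn, if_neg]
          rw [Finset.insert_inter_of_notMem (by simp [hkU]), Finset.inter_comm U T,
            ← Finset.inter_assoc, hdis]
          simp
        rw [Pi.add_apply] at h6 h7
        omega
    · have h3 := sum_add_single (p - Pi.single k 1) k E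
      rw [sub_add_cancel, if_pos hk, h2, Pi.add_apply, hkE] at h3
      omega
    · exact Finset.subset_sdiff.2 ⟨hTE, by
        rw [Finset.disjoint_iff_inter_eq_empty, Finset.inter_comm]; exact hdis⟩
    · have h3 := sum_add_single (p - Pi.single k 1) k T
      rw [sub_add_cancel, if_pos hkT, hpT] at h3
      omega

lemma ncard_basePts_add_simplexFn_singleton {E : Finset α} {k : α} (hk : k ∈ E)
    (f : Finset α → ℤ) : (basePts E (f + simplexFn {k})).ncard = (basePts E f).ncard := by
  have hs : ∀ T, simplexFn {k} T = if k ∈ T then 1 else 0 := by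
    intro T
    by_cases h : k ∈ T <;> simp [simplexFn, h]
  symm
  refine Set.ncard_congr (fun x _ => x + (Pi.single k 1 : α → ℤ)) ?_ ?_ ?_
  · rintro x ⟨h0, h1, h2⟩
    refine ⟨fun i hi => ?_, fun U hU => ?_, ?_⟩
    · have : i ≠ k := fun h => hi (h ▸ hk)
      simp [h0 i hi, this]
    · rw [sum_add_single, Pi.add_apply, hs]
      linarith [h1 U hU]
    · rw [sum_add_single, Pi.add_apply, hs, h2]
  · rintro x y _ _ h
    exact add_right_cancel h
  · rintro p ⟨h0, h1, h2⟩
    have h3 := fun U => sum_add_single (p - Pi.single k 1) k U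
    simp only [sub_add_cancel] at h3
    refine ⟨p - Pi.single k 1, ⟨fun i hi => ?_, fun U hU => ?_, ?_⟩, by simp⟩
    · have : i ≠ k := fun h => hi (h ▸ hk)
      simp [h0 i hi, this]
    · have := h1 U hU
      rw [h3, Pi.add_apply, hs] at this
      linarith
    · rw [h3, Pi.add_apply, hs] at h2
      linarith

end LatticePoints

section Polynomiality

/-- Functions on `ι → ℕ` given by a polynomial with rational coefficients. -/
def IsPolyFn {ι : Type} (G : (ι → ℕ) → ℚ) : Prop :=
  ∃ R : MvPolynomial ι ℚ, ∀ n, G n = MvPolynomial.eval (fun i => (n i : ℚ)) R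

lemma IsPolyFn.const {ι : Type} (c : ℚ) : IsPolyFn fun _ : ι → ℕ => c :=
  ⟨MvPolynomial.C c, by simp⟩

lemma IsPolyFn.add {ι : Type} {F G : (ι → ℕ) → ℚ} (hF : IsPolyFn F) (hG : IsPolyFn G) :
    IsPolyFn fun n => F n + G n := by
  obtain ⟨R, hR⟩ := hF
  obtain ⟨Q, hQ⟩ := hG
  exact ⟨R + Q, by simp [hR, hQ]⟩

lemma IsPolyFn.sub {ι : Type} {F G : (ι → ℕ) → ℚ} (hF : IsPolyFn F) (hG : IsPolyFn G) :
    IsPolyFn fun n => F n - G n := by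
  obtain ⟨R, hR⟩ := hF
  obtain ⟨Q, hQ⟩ := hG
  exact ⟨R - Q, by simp [hR, hQ]⟩

lemma IsPolyFn.mul {ι : Type} {F G : (ι → ℕ) → ℚ} (hF : IsPolyFn F) (hG : IsPolyFn G) :
    IsPolyFn fun n => F n * G n := by
  obtain ⟨R, hR⟩ := hF
  obtain ⟨Q, hQ⟩ := hG
  exact ⟨R * Q, by simp [hR, hQ]⟩

lemma IsPolyFn.sum {ι κ : Type} (s : Finset κ) {F : κ → (ι → ℕ) → ℚ}
    (hF : ∀ k ∈ s, IsPolyFn (F k)) : IsPolyFn fun n => ∑ k ∈ s, F k n := by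
  classical
  induction s using Finset.induction_on with
  | empty => simpa using IsPolyFn.const 0
  | insert a s ha ih =>
    simp only [Finset.sum_insert ha]
    exact (hF a (by simp)).add (ih fun k hk => hF k (by simp [hk]))

lemma exists_sum_range_pow_eq_eval (e : ℕ) :
    ∃ F : Polynomial ℚ, ∀ m : ℕ, ∑ j ∈ Finset.range m, (j : ℚ) ^ e = F.eval (m : ℚ) := by
  refine ⟨∑ i ∈ Finset.range (e + 1), Polynomial.C (bernoulli i * ((e + 1).choose i) / (e + 1)) *
    Polynomial.X ^ (e + 1 - i), fun m => ?_⟩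
  rw [sum_range_pow, Polynomial.eval_finsetSum]
  refine Finset.sum_congr rfl fun i _ => ?_
  simp only [Polynomial.eval_mul, Polynomial.eval_C, Polynomial.eval_pow, Polynomial.eval_X]
  ring

lemma isPolyFn_sum_range {ι : Type} [Fintype ι] (c : ι → ℕ) {F : (Option ι → ℕ) → ℚ}
    (hF : IsPolyFn F) :
    IsPolyFn fun n : ι → ℕ =>
      ∑ j ∈ Finset.range (∑ i, n i * c i), F fun o => o.elim j n := by
  obtain ⟨Q, hQ⟩ := hF
  suffices h : ∀ e : ℕ, IsPolyFn fun n : ι → ℕ => ∑ j ∈ Finset.range (∑ i, n i * c i),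
      (j : ℚ) ^ e * MvPolynomial.eval (fun o => ((o.elim j n : ℕ) : ℚ)) Q by
    simpa [hQ] using h 0
  clear hQ
  induction Q using MvPolynomial.induction_on with
  | C a =>
    intro e
    obtain ⟨F, hF⟩ := exists_sum_range_pow_eq_eval e
    refine ⟨Polynomial.aeval (∑ i, MvPolynomial.X i * MvPolynomial.C (c i : ℚ)) F *
      MvPolynomial.C a, fun n => ?_⟩
    simp only [MvPolynomial.eval_C, ← Finset.sum_mul, hF, map_mul]
    congr 1
    rw [← MvPolynomial.coe_aeval_eq_eval, RingHom.coe_coe, ← Polynomial.aeval_algHom_apply]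
    simp [Polynomial.aeval_def, Polynomial.eval₂_eq_eval_map]
  | add p q hp hq =>
    intro e
    simpa only [map_add, mul_add, Finset.sum_add_distrib] using (hp e).add (hq e)
  | mul_X p o hp =>
    intro e
    cases o with
    | none =>
      convert hp (e + 1) using 2 with n
      refine Finset.sum_congr rfl fun j _ => ?_
      simp
      ring
    | some i =>
      have h : IsPolyFn fun n : ι → ℕ => (n i : ℚ) := ⟨MvPolynomial.X i, by simp⟩
      convert h.mul (hp e) using 2
      rw [Finset.mul_sum]
      refine Finset.sum_congr rfl fun j _ => ?_
      simp
      ring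

variable {α : Type} [DecidableEq α]

lemma exists_powerset_sum_eq (g : Finset α → ℤ) :
    ∃ y : Finset α → ℤ, ∀ T, g T = ∑ S ∈ T.powerset, y S := by
  refine ⟨Finset.strongInduction fun T ih =>
    g T - ∑ S ∈ T.ssubsets.attach, ih S (Finset.mem_ssubsets.1 S.2), fun T => ?_⟩
  rw [← Finset.insert_erase (Finset.mem_powerset_self T),
    Finset.sum_insert (Finset.notMem_erase _ _), Finset.strongInduction_eq,
    Finset.sum_attach T.ssubsets (f := fun S => Finset.strongInduction (fun T ih =>
      g T - ∑ S ∈ T.ssubsets.attach, ih S (Finset.mem_ssubsets.1 S.2)) S)]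
  simp [Finset.ssubsets]

lemma exists_simplexFn_decomp (E : Finset α) {f : Finset α → ℤ} (hf : f ∅ = 0) :
    ∃ y : Finset α → ℤ, ∀ T, T ⊆ E → f T = ∑ S ∈ E.powerset, y S * simplexFn S T := by
  obtain ⟨y, hy⟩ := exists_powerset_sum_eq fun T => f E - f (E \ T)
  refine ⟨y, fun T hT => ?_⟩
  have h1 := hy E
  have h2 := hy (E \ T)
  simp only [Finset.sdiff_self, hf, Finset.sdiff_sdiff_eq_self hT] at h1 h2
  have h3 : ∑ S ∈ E.powerset, y S * simplexFn S T =
      ∑ S ∈ E.powerset, y S - ∑ S ∈ (E \ T).powerset, y S := by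
    have h4 : (E \ T).powerset = E.powerset.filter fun S => ¬ (S ∩ T).Nonempty := by
      ext S
      simp [Finset.subset_sdiff, Finset.disjoint_iff_inter_eq_empty]
    rw [h4, Finset.sum_filter, ← Finset.sum_sub_distrib]
    refine Finset.sum_congr rfl fun S _ => ?_
    unfold simplexFn
    split_ifs <;> simp
  linarith

lemma exists_nat_simplexFn_decomp (E : Finset α) {f : Finset α → ℤ} (hf : f ∅ = 0) :
    ∃ a b : Finset α → ℕ, ∀ T, T ⊆ E →
      (f + ∑ S ∈ E.powerset, a S • simplexFn S) T = (∑ S ∈ E.powerset, b S • simplexFn S) T := by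
  obtain ⟨y, hy⟩ := exists_simplexFn_decomp E hf
  refine ⟨fun S => (-y S).toNat, fun S => (y S).toNat, fun T hT => ?_⟩
  rw [Pi.add_apply, hy T hT]
  simp only [Finset.sum_apply, Pi.smul_apply, ← Finset.sum_add_distrib]
  refine Finset.sum_congr rfl fun S _ => ?_
  simp only [← natCast_zsmul, smul_eq_mul, ← add_mul]
  congr 1
  omega

variable [Fintype α]

/-- Counting lattice points in Minkowski combinations of base polytopes on `E` is polynomial. -/
def BasePoly (E : Finset α) : Prop :=
  ∀ (ι : Type) [Fintype ι] (f : ι → Finset α → ℤ), (∀ i, Submod (f i)) →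
    IsPolyFn fun n : ι → ℕ => ((basePts E (∑ i, n i • f i)).ncard : ℚ)

omit [Fintype α] in
lemma Submod.family {ι : Type} [Fintype ι] {f : ι → Finset α → ℤ} (hf : ∀ i, Submod (f i))
    (n : ι → ℕ) : Submod (∑ i, n i • f i) :=
  Submod.sum (f := fun i => n i • f i) _ fun i => (hf i).nsmul (n i)

omit [Fintype α] in
lemma contract_family {ι : Type} [Fintype ι] (A : Finset α) (f : ι → Finset α → ℤ) (n : ι → ℕ) :
    contract A (∑ i, n i • f i) = ∑ i, n i • contract A (f i) := by
  funext T
  simp [contract, Finset.sum_apply, mul_sub]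

omit [Fintype α] [DecidableEq α] in
lemma ncard_basePts_empty {f : Finset α → ℤ} (hf : f ∅ = 0) : (basePts ∅ f).ncard = 1 := by
  rw [Set.ncard_eq_one]
  refine ⟨0, Set.eq_singleton_iff_unique_mem.2 ⟨⟨by simp, fun T hT => ?_, by simp [hf]⟩,
    fun x hx => funext fun i => hx.1 i (by simp)⟩⟩
  rw [Finset.subset_empty.1 hT]
  simp [hf]

lemma isPolyFn_freePts {k : α} (E : Finset α) (hk : k ∈ E) (hE : ∀ T, T ⊆ E → BasePoly T)
    {ι : Type} [Fintype ι] {f : ι → Finset α → ℤ} (hf : ∀ i, Submod (f i)) :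
    IsPolyFn fun n : ι → ℕ => ((freePts E k (∑ i, n i • f i)).ncard : ℚ) := by
  induction E using Finset.strongInduction with
  | H E ih =>
    have h : ∀ n : ι → ℕ, ((freePts E k (∑ i, n i • f i)).ncard : ℚ) =
        (basePts E (∑ i, n i • f i)).ncard - ∑ T ∈ (E.powerset.filter (k ∈ ·)).erase E,
          ((freePts T k (∑ i, n i • f i)).ncard : ℚ) *
            (basePts (E \ T) (∑ i, n i • contract T (f i))).ncard := by
      intro n
      have hmem : E ∈ E.powerset.filter (k ∈ ·) := by simp [hk]
      rw [ncard_basePts hk (Submod.family hf n), ← Finset.add_sum_erase _ _ hmem,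
        Finset.sdiff_self, ncard_basePts_empty ((Submod.family hf n).contract E).1]
      simp only [contract_family]
      push_cast
      ring
    simp only [h]
    refine (hE E subset_rfl ι f hf).sub (IsPolyFn.sum _ fun T hT => ?_)
    simp only [Finset.mem_erase, Finset.mem_filter, Finset.mem_powerset] at hT
    refine (ih T (hT.2.1.ssubset_of_ne hT.1) hT.2.2 fun U hU => hE U (hU.trans hT.2.1)).mul ?_
    exact hE (E \ T) Finset.sdiff_subset ι _ fun i => (hf i).contract T

lemma isPolyFn_add_simplexFn_sub {E : Finset α} (hE : ∀ T, T ⊂ E → BasePoly T) (S : Finset α)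
    (hS : S ⊆ E) {ι : Type} [Fintype ι] {f : ι → Finset α → ℤ} (hf : ∀ i, Submod (f i)) :
    IsPolyFn fun n : ι → ℕ => ((basePts E (∑ i, n i • f i + simplexFn S)).ncard : ℚ) -
      (basePts E (∑ i, n i • f i)).ncard := by
  induction S using Finset.induction_on with
  | empty =>
    have h0 : simplexFn (∅ : Finset α) = 0 := by funext T; simp [simplexFn]
    simpa [h0] using IsPolyFn.const 0
  | insert k S hkS ih =>
    have hk : k ∈ E := hS (by simp)
    have hS' : S ⊆ E := (Finset.subset_insert k S).trans hS
    rcases S.eq_empty_or_nonempty with rfl | hne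
    · simpa [ncard_basePts_add_simplexFn_singleton hk] using IsPolyFn.const 0
    · have h : ∀ n : ι → ℕ, ((basePts E (∑ i, n i • f i + simplexFn (insert k S))).ncard : ℚ) -
          (basePts E (∑ i, n i • f i)).ncard =
          (((basePts E (∑ i, n i • f i + simplexFn S)).ncard : ℚ) -
            (basePts E (∑ i, n i • f i)).ncard) + ∑ T ∈ (E \ S).powerset with k ∈ T,
          ((freePts T k (∑ i, n i • f i)).ncard : ℚ) *
            (basePts (E \ T) (∑ i, n i • contract T (f i))).ncard := by
        intro n
        rw [ncard_basePts_add_simplexFn hS' hk hne (Submod.family hf n)]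
        simp only [contract_family]
        push_cast
        ring
      simp only [h]
      refine (ih hS').add (IsPolyFn.sum _ fun T hT => ?_)
      simp only [Finset.mem_filter, Finset.mem_powerset] at hT
      obtain ⟨s, hs⟩ := hne
      have hTE : T ⊂ E := (Finset.ssubset_iff_of_subset (hT.1.trans Finset.sdiff_subset)).2
        ⟨s, hS' hs, fun h => (Finset.mem_sdiff.1 (hT.1 h)).2 hs⟩
      refine (isPolyFn_freePts T hT.2 (fun U hU => hE U (hU.trans_ssubset hTE)) hf).mul ?_
      refine hE _ (Finset.sdiff_ssubset hTE.1 ⟨k, hT.2⟩) ι _ fun i => (hf i).contract T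

lemma isPolyFn_add_nsmul_simplexFn_sub {E : Finset α} (hE : ∀ T, T ⊂ E → BasePoly T)
    {S : Finset α} (hS : S ⊆ E) {ι : Type} [Fintype ι] {f : ι → Finset α → ℤ}
    (hf : ∀ i, Submod (f i)) (c : ι → ℕ) :
    IsPolyFn fun n : ι → ℕ => ((basePts E (∑ i, n i • (f i + c i • simplexFn S))).ncard : ℚ) -
      (basePts E (∑ i, n i • f i)).ncard := by
  have h := isPolyFn_sum_range c (isPolyFn_add_simplexFn_sub hE S hS (ι := Option ι)
    (f := fun o => o.elim (simplexFn S) f) fun o => by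
      cases o with
      | none => exact submod_simplexFn S
      | some i => exact hf i)
  convert h using 2 with n
  have h1 : ∀ j : ℕ, ∑ o : Option ι, (o.elim j n) • (o.elim (simplexFn S) f : Finset α → ℤ) =
      ∑ i, n i • f i + j • simplexFn S := by
    intro j
    rw [Fintype.sum_option, add_comm]
    rfl
  simp only [h1, add_assoc, ← succ_nsmul]
  rw [Finset.sum_range_sub fun j =>
    ((basePts E (∑ i, n i • f i + j • simplexFn S)).ncard : ℚ)]
  simp [smul_add, Finset.sum_add_distrib, mul_smul, Finset.sum_smul]

theorem basePoly (E : Finset α) : BasePoly E := by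
  induction E using Finset.strongInduction with
  | H E ih =>
    have walk : ∀ (ι : Type) [Fintype ι] (f : ι → Finset α → ℤ), (∀ i, Submod (f i)) →
        ∀ (c : ι → Finset α → ℕ) (s : Finset (Finset α)), s ⊆ E.powerset →
        IsPolyFn fun n : ι → ℕ =>
          ((basePts E (∑ i, n i • (f i + ∑ S ∈ s, c i S • simplexFn S))).ncard : ℚ) -
            (basePts E (∑ i, n i • f i)).ncard := by
      intro ι _ f hf c s
      induction s using Finset.induction_on with
      | empty => intro _; simpa using IsPolyFn.const 0
      | insert A s hA ihs =>
        intro hs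
        have hA' : A ⊆ E := Finset.mem_powerset.1 (hs (by simp))
        have h1 := isPolyFn_add_nsmul_simplexFn_sub ih hA'
          (f := fun i => f i + ∑ S ∈ s, c i S • simplexFn S)
          (fun i => (hf i).add (Submod.sum (f := fun S => c i S • simplexFn S) _
            fun S => (submod_simplexFn S).nsmul _)) fun i => c i A
        convert h1.add (ihs ((Finset.subset_insert A s).trans hs)) using 2 with n
        rw [sub_add_sub_cancel]
        simp only [Finset.sum_insert hA, add_assoc, add_comm (c _ A • simplexFn A)]
    intro ι _ f hf
    choose a b hab using fun i => exists_nat_simplexFn_decomp E (hf i).1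
    have h1 := walk ι f hf a E.powerset subset_rfl
    have h2 := walk ι 0 (fun _ => ⟨rfl, by simp⟩) b E.powerset subset_rfl
    have h3 : ∀ n : ι → ℕ,
        basePts E (∑ i, n i • (f i + ∑ S ∈ E.powerset, a i S • simplexFn S)) =
        basePts E (∑ i, n i • ((0 : ι → Finset α → ℤ) i +
          ∑ S ∈ E.powerset, b i S • simplexFn S)) := by
      refine fun n => basePts_congr fun T hT => ?_
      rw [Finset.sum_apply, Finset.sum_apply]
      refine Finset.sum_congr rfl fun i _ => ?_
      rw [Pi.smul_apply, Pi.smul_apply, hab i T hT, Pi.zero_apply, zero_add]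
    have h4 := (h2.sub h1).add (IsPolyFn.const ((basePts E (0 : Finset α → ℤ)).ncard : ℚ))
    convert h4 using 2 with n
    rw [h3 n]
    simp

end Polynomiality

section LinearCoefficient

lemma exists_linear_coeff_one {ι : Type} [Fintype ι] (R : MvPolynomial ι ℚ) :
    ∃ L : ι → ℚ, ∀ v : ι → ℚ, (MvPolynomial.aeval
      (fun i => Polynomial.C (v i) * Polynomial.X) R : Polynomial ℚ).coeff 1 = ∑ i, v i * L i := by
  classical
  induction R using MvPolynomial.induction_on with
  | C a => exact ⟨0, fun v => by simp [Polynomial.algebraMap_eq]⟩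
  | add p q hp hq =>
    obtain ⟨L, hL⟩ := hp
    obtain ⟨M, hM⟩ := hq
    exact ⟨L + M, fun v => by simp [hL, hM, mul_add, Finset.sum_add_distrib]⟩
  | mul_X p j hp =>
    clear hp
    refine ⟨Pi.single j (MvPolynomial.constantCoeff p), fun v => ?_⟩
    have h0 : (MvPolynomial.aeval (fun i => Polynomial.C (v i) * Polynomial.X) p :
        Polynomial ℚ).coeff 0 = MvPolynomial.constantCoeff p := by
      induction p using MvPolynomial.induction_on with
      | C a => simp [Polynomial.algebraMap_eq]
      | add p q hp hq => simp [hp, hq]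
      | mul_X p j _ => simp
    rw [map_mul, MvPolynomial.aeval_X, ← mul_assoc, Polynomial.coeff_mul_X, Polynomial.coeff_mul_C,
      h0, Finset.sum_eq_single j]
    · simp [mul_comm]
    · intro b _ hb; simp [hb]
    · simp

lemma eval_aeval_C_mul_X {ι : Type} (R : MvPolynomial ι ℚ) (v : ι → ℚ) (t : ℚ) :
    (MvPolynomial.aeval (fun i => Polynomial.C (v i) * Polynomial.X) R : Polynomial ℚ).eval t =
      MvPolynomial.eval (fun i => t * v i) R := by
  induction R using MvPolynomial.induction_on with
  | C a => simp [Polynomial.algebraMap_eq]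
  | add p q hp hq => simp [hp, hq]
  | mul_X p j hp => simp [hp, mul_comm (v j)]

lemma polynomial_eq_of_eval_nat_eq {K : Type} [Field K] [CharZero K] {p q : Polynomial K}
    (h : ∀ n : ℕ, 0 < n → p.eval (n : K) = q.eval (n : K)) : p = q := by
  refine Polynomial.eq_of_infinite_eval_eq p q (Set.Infinite.mono ?_
    (Set.infinite_range_of_injective (f := fun n : ℕ => ((n + 1 : ℕ) : K))
      fun a b hab => by simpa using hab))
  rintro _ ⟨n, rfl⟩
  exact h (n + 1) n.succ_pos

/-- The polynomial `n ↦ (n + k).choose k`. -/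
noncomputable def choosePoly (k : ℕ) : Polynomial ℚ :=
  ∏ i ∈ Finset.range k, (Polynomial.C ((i + 1 : ℕ) : ℚ)⁻¹ * Polynomial.X + 1)

lemma eval_choosePoly (k n : ℕ) : (choosePoly k).eval (n : ℚ) = ((n + k).choose k : ℚ) := by
  induction k with
  | zero => simp [choosePoly]
  | succ k ih =>
    rw [choosePoly, Finset.prod_range_succ, Polynomial.eval_mul, ← choosePoly, ih]
    have h : ((n + k + 1 : ℕ) : ℚ) * ((n + k).choose k : ℚ) =
        ((n + (k + 1)).choose (k + 1) : ℚ) * ((k + 1 : ℕ) : ℚ) := by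
      exact_mod_cast Nat.add_one_mul_choose_eq (n + k) k
    have hk : ((k + 1 : ℕ) : ℚ) ≠ 0 := by positivity
    simp only [Polynomial.eval_add, Polynomial.eval_mul, Polynomial.eval_C, Polynomial.eval_X,
      Polynomial.eval_one]
    refine mul_right_cancel₀ hk ?_
    rw [← h]
    field_simp
    push_cast
    ring

lemma coeff_one_choosePoly (k : ℕ) : (choosePoly k).coeff 1 = harmonic k := by
  have h0 : ∀ k, (choosePoly k).coeff 0 = 1 := fun k => by
    rw [Polynomial.coeff_zero_eq_eval_zero]
    simpa using eval_choosePoly k 0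
  induction k with
  | zero => simp [choosePoly, Polynomial.coeff_one]
  | succ k ih =>
    rw [choosePoly, Finset.prod_range_succ, ← choosePoly, mul_add, mul_one, ← mul_assoc,
      Polynomial.coeff_add, Polynomial.coeff_mul_X, Polynomial.coeff_mul_C, h0, ih, harmonic_succ]
    ring

variable {α : Type} [DecidableEq α]

lemma mem_basePts_nsmul_simplexFn {E S : Finset α} (hS : S ⊆ E) (hne : S.Nonempty) (n : ℕ)
    (x : α → ℤ) : x ∈ basePts E (n • simplexFn S) ↔
      (∀ i, i ∉ S → x i = 0) ∧ (∀ i, 0 ≤ x i) ∧ ∑ i ∈ S, x i = n := by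
  have hE : (n • simplexFn S) E = n := by
    simp [simplexFn, Finset.inter_eq_left.2 hS, hne]
  have hle : ∀ T, (n • simplexFn S) T ≤ n := fun T => by
    simp only [Pi.smul_apply, simplexFn]; split_ifs <;> simp
  constructor
  · rintro ⟨h0, h1, h2⟩
    have hnn : ∀ i, 0 ≤ x i := fun i => by
      by_cases hi : i ∈ E
      · have := h1 _ (Finset.erase_subset i E)
        have h3 := Finset.add_sum_erase E x hi
        have := hle (E.erase i)
        linarith
      · rw [h0 i hi]
    have hz : ∀ i, i ∉ S → x i = 0 := fun i hi => by
      by_cases hiE : i ∈ E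
      · have := h1 {i} (by simpa using hiE)
        have h3 := hnn i
        simp [simplexFn, hi] at this
        omega
      · exact h0 i hiE
    refine ⟨hz, hnn, ?_⟩
    rw [← hE, ← h2]
    exact Finset.sum_subset hS fun i _ hi => hz i hi
  · rintro ⟨h0, h1, h2⟩
    have hsum : ∀ T, ∑ i ∈ T, x i = ∑ i ∈ S ∩ T, x i := fun T =>
      (Finset.sum_subset Finset.inter_subset_right fun i hi hi' =>
        h0 i fun h => hi' (by simp [h, hi])).symm
    refine ⟨fun i hi => h0 i fun h => hi (hS h), fun T _ => ?_, ?_⟩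
    · rw [hsum T]
      by_cases hT : (S ∩ T).Nonempty
      · have : (n • simplexFn S) T = n := by simp [simplexFn, hT]
        rw [this, ← h2]
        exact Finset.sum_le_sum_of_subset_of_nonneg Finset.inter_subset_left fun i _ _ => h1 i
      · rw [Finset.not_nonempty_iff_eq_empty.1 hT]
        simp [simplexFn, hT]
    · rw [hE, hsum E, Finset.inter_eq_left.2 hS, h2]

lemma ncard_basePts_nsmul_simplexFn {E S : Finset α} (hS : S ⊆ E) (hne : S.Nonempty) (n : ℕ) :
    (basePts E (n • simplexFn S)).ncard = (n + (S.card - 1)).choose (S.card - 1) := by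
  have h : (basePts E (n • simplexFn S)).ncard = (S.finsuppAntidiag n).card := by
    rw [← Set.ncard_coe_finset]
    symm
    refine Set.ncard_congr (fun x _ => fun i => (x i : ℤ)) ?_ ?_ ?_
    · intro x hx
      rw [Finset.mem_coe, Finset.mem_finsuppAntidiag] at hx
      refine (mem_basePts_nsmul_simplexFn hS hne n _).2 ⟨fun i hi => ?_, fun i => by simp, ?_⟩
      · exact_mod_cast Finsupp.notMem_support_iff.1 fun h => hi (hx.2 h)
      · exact_mod_cast hx.1
    · intro x y _ _ hxy
      ext i
      exact_mod_cast congrFun hxy i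
    · intro x hx
      obtain ⟨h0, h1, h2⟩ := (mem_basePts_nsmul_simplexFn hS hne n x).1 hx
      refine ⟨Finsupp.onFinset S (fun i => (x i).toNat) fun i hi => ?_, ?_, ?_⟩
      · by_contra h
        simp [h0 i h] at hi
      · rw [Finset.mem_coe, Finset.mem_finsuppAntidiag]
        refine ⟨?_, Finsupp.support_onFinset_subset⟩
        zify
        simpa [h1] using h2
      · funext i
        simp [h1]
  have hc := hne.card_pos
  rw [h, Finset.card_finsuppAntidiag_nat_eq_choose,
    show S.card + n - 1 = n + (S.card - 1) by omega, Nat.choose_symm_add]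

/-- The value of the beta integral `∫₀¹ s ^ j * (1 - s) ^ l`. -/
def betaWeight (j l : ℕ) : ℚ := (j.factorial * l.factorial : ℚ) / (j + l + 1).factorial

lemma betaWeight_succ_add (j l : ℕ) :
    betaWeight j (l + 1) + betaWeight (j + 1) l = betaWeight j l := by
  unfold betaWeight
  rw [show j + (l + 1) + 1 = j + l + 1 + 1 by ring, show j + 1 + l + 1 = j + l + 1 + 1 by ring]
  have h := Nat.factorial_pos (j + l + 1)
  rw [Nat.factorial_succ (j + l + 1), Nat.factorial_succ j, Nat.factorial_succ l]
  push_cast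
  field_simp
  ring

lemma betaWeight_zero_right (m : ℕ) : betaWeight m 0 = ((m + 1 : ℕ) : ℚ)⁻¹ := by
  unfold betaWeight
  have h := Nat.factorial_pos m
  rw [add_zero, Nat.factorial_succ]
  push_cast
  field_simp
  simp

lemma betaWeight_zero_left (m : ℕ) : betaWeight 0 m = ((m + 1 : ℕ) : ℚ)⁻¹ := by
  rw [← betaWeight_zero_right]
  simp [betaWeight]

lemma sum_powerset_betaWeight (X : Finset α) (j l : ℕ) :
    ∑ S ∈ X.powerset, betaWeight (j + S.card) (l + (X.card - S.card)) = betaWeight j l := by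
  induction X using Finset.induction_on generalizing j l with
  | empty => simp
  | insert a X ha ih =>
    rw [Finset.sum_powerset_insert ha, ← betaWeight_succ_add j l, ← ih j (l + 1), ← ih (j + 1) l]
    congr 1 <;> refine Finset.sum_congr rfl fun S hS => ?_
    · have := Finset.card_le_card (Finset.mem_powerset.1 hS)
      rw [Finset.card_insert_of_notMem ha]
      congr 1
      omega
    · rw [Finset.card_insert_of_notMem ha,
        Finset.card_insert_of_notMem fun h => ha (Finset.mem_powerset.1 hS h)]
      congr 1 <;> omega

lemma sum_powerset_betaWeight_eq_harmonic (X : Finset α) :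
    ∑ S ∈ X.powerset, (if S = X then 0 else betaWeight S.card (X.card - S.card - 1)) =
      harmonic X.card := by
  induction X using Finset.induction_on with
  | empty => simp
  | insert a X ha ih =>
    rw [Finset.sum_powerset_insert ha, Finset.card_insert_of_notMem ha, harmonic_succ, ← ih,
      ← betaWeight_zero_right, ← Finset.sum_add_distrib]
    have h : betaWeight X.card 0 = ∑ S ∈ X.powerset, if S = X then betaWeight X.card 0 else 0 := by
      simp
    rw [h, ← Finset.sum_add_distrib]
    refine Finset.sum_congr rfl fun S hS => ?_
    have hSX := Finset.mem_powerset.1 hS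
    have haS : a ∉ S := fun h => ha (hSX h)
    have h1 : S ≠ insert a X := fun h => haS (by simp [h])
    have h2 : insert a S = insert a X ↔ S = X :=
      ⟨fun h => by rw [← Finset.erase_insert haS, h, Finset.erase_insert ha], fun h => by rw [h]⟩
    simp only [h1, h2, if_false, Finset.card_insert_of_notMem haS]
    by_cases hS' : S = X
    · subst hS'; simp
    · have := Finset.card_lt_card (hSX.ssubset_of_ne hS')
      simp only [hS', if_false, add_zero]
      rw [← betaWeight_succ_add S.card (X.card - S.card - 1)]
      congr 2 <;> omega

/-- The weight of a face `T` in the linear Ehrhart coefficient. -/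
def faceWeight (E T : Finset α) : ℚ :=
  if T = ∅ ∨ T = E then 0 else betaWeight (T.card - 1) (E.card - T.card - 1)

lemma faceWeight_nonneg (E T : Finset α) : 0 ≤ faceWeight E T := by
  unfold faceWeight betaWeight
  split_ifs <;> positivity

/-- The linear coefficient of the Ehrhart polynomial as a functional of the submodular function. -/
def linearFunctional (E : Finset α) : (Finset α → ℤ) →+ ℚ where
  toFun g := ∑ T ∈ E.powerset, faceWeight E T * g T - harmonic (E.card - 1) * g E
  map_zero' := by simp
  map_add' f g := by
    simp only [Pi.add_apply, Int.cast_add, mul_add, Finset.sum_add_distrib]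
    ring

lemma linearFunctional_apply (E : Finset α) (g : Finset α → ℤ) : linearFunctional E g =
    ∑ T ∈ E.powerset, faceWeight E T * g T - harmonic (E.card - 1) * g E := rfl

lemma linearFunctional_congr {E : Finset α} {f g : Finset α → ℤ} (h : ∀ T, T ⊆ E → f T = g T) :
    linearFunctional E f = linearFunctional E g := by
  rw [linearFunctional_apply, linearFunctional_apply, h E subset_rfl]
  congr 1
  exact Finset.sum_congr rfl fun T hT => by rw [h T (Finset.mem_powerset.1 hT)]

lemma sum_powerset_ite_mem {E X : Finset α} {i : α} (hi : i ∉ X) (hX : insert i X ⊆ E)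
    (g : Finset α → ℚ) :
    ∑ T ∈ E.powerset, (if i ∈ T ∧ T ⊆ insert i X then g T else 0) =
      ∑ T ∈ X.powerset, g (insert i T) := by
  rw [← Finset.sum_filter]
  symm
  refine Finset.sum_nbij' (insert i) (Finset.erase · i) ?_ ?_ ?_ ?_ fun _ _ => rfl
  · intro T hT
    have h := Finset.insert_subset_insert i (Finset.mem_powerset.1 hT)
    simp only [Finset.mem_filter, Finset.mem_powerset]
    exact ⟨h.trans hX, by simp, h⟩
  · intro T hT
    simp only [Finset.mem_filter, Finset.mem_powerset] at hT ⊢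
    exact Finset.subset_insert_iff.1 hT.2.2
  · intro T hT
    exact Finset.erase_insert fun h => hi (Finset.mem_powerset.1 hT h)
  · intro T hT
    simp only [Finset.mem_filter] at hT
    exact Finset.insert_erase hT.2.1

lemma linearFunctional_simplexFn {E A : Finset α} (hA : A ⊆ E) :
    linearFunctional E (simplexFn A) = harmonic (A.card - 1) := by
  induction A using Finset.induction_on with
  | empty => simp [linearFunctional_apply, simplexFn]
  | insert i A hi ih =>
    have hiE : i ∈ E := hA (by simp)
    have hAE : A ⊆ E := (Finset.subset_insert i A).trans hA
    rw [Finset.card_insert_of_notMem hi, Nat.add_sub_cancel]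
    rcases A.eq_empty_or_nonempty with rfl | hne
    · have h := sum_powerset_ite_mem (Finset.notMem_erase i E)
        (Finset.insert_erase hiE).subset (faceWeight E)
      rw [Finset.insert_erase hiE] at h
      have h2 : ∑ T ∈ E.powerset, faceWeight E T * simplexFn (insert i ∅) T =
          ∑ T ∈ E.powerset, (if i ∈ T ∧ T ⊆ E then faceWeight E T else 0) :=
        Finset.sum_congr rfl fun T hT => by
          by_cases hT' : i ∈ T <;> simp [simplexFn, hT', Finset.mem_powerset.1 hT]
      rw [linearFunctional_apply, h2, h]
      have h3 := sum_powerset_betaWeight_eq_harmonic (E.erase i)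
      rw [Finset.card_erase_of_mem hiE] at h3
      rw [← h3]
      simp only [simplexFn, insert_empty_eq, Finset.singleton_inter_of_mem hiE,
        Finset.singleton_nonempty, if_true, Int.cast_one, mul_one, Finset.card_empty, harmonic_zero]
      rw [sub_eq_zero]
      refine Finset.sum_congr rfl fun T hT => ?_
      have hiT : i ∉ T := fun h => by simpa using Finset.mem_powerset.1 hT h
      have h4 : insert i T = E ↔ T = E.erase i :=
        ⟨fun h => by rw [← h, Finset.erase_insert hiT], fun h => by
          rw [h, Finset.insert_erase hiE]⟩
      simp only [faceWeight, h4, Finset.insert_ne_empty, false_or,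
        Finset.card_insert_of_notMem hiT, Nat.add_sub_cancel]
      congr 2
      omega
    · have hc := hne.card_pos
      have hX : i ∉ E \ insert i A := by simp
      have hXE : insert i (E \ insert i A) = E \ A := by
        ext j
        by_cases hj : j = i <;> simp [hj, hiE, hi]
      have h := sum_powerset_ite_mem hX (hXE ▸ Finset.sdiff_subset) (faceWeight E)
      have h1 : linearFunctional E (simplexFn (insert i A)) = linearFunctional E (simplexFn A) +
          ∑ T ∈ E.powerset,
            (if i ∈ T ∧ T ⊆ insert i (E \ insert i A) then faceWeight E T else 0) := by
        have h2 : (insert i A ∩ E).Nonempty := ⟨i, by simp [hiE]⟩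
        have h3 : (A ∩ E).Nonempty := by rwa [Finset.inter_eq_left.2 hAE]
        simp only [linearFunctional_apply, hXE, simplexFn, h2, h3, if_true]
        rw [sub_add_eq_add_sub, ← Finset.sum_add_distrib]
        congr 1
        refine Finset.sum_congr rfl fun T hT => ?_
        have hTE := Finset.mem_powerset.1 hT
        have h4 : T ⊆ E \ A ↔ ¬ (A ∩ T).Nonempty := by
          rw [Finset.subset_sdiff, Finset.not_nonempty_iff_eq_empty, Finset.inter_comm,
            Finset.disjoint_iff_inter_eq_empty]
          exact and_iff_right hTE
        simp only [h4]
        by_cases hiT : i ∈ T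
        · by_cases h6 : (A ∩ T).Nonempty <;> simp [h6, hiT]
        · rw [Finset.insert_inter_of_notMem hiT]
          simp [hiT]
      rw [h1, h, ih hAE]
      have h7 := sum_powerset_betaWeight (E \ insert i A) 0 (A.card - 1)
      rw [betaWeight_zero_left, Nat.sub_add_cancel hc] at h7
      obtain ⟨a, ha⟩ : ∃ a, A.card = a + 1 := ⟨A.card - 1, by omega⟩
      rw [ha, Nat.add_sub_cancel, harmonic_succ, ← ha, ← h7]
      congr 1
      refine Finset.sum_congr rfl fun T hT => ?_
      have hTX := Finset.mem_powerset.1 hT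
      have hiT : i ∉ T := fun h => hX (hTX h)
      have h8 : insert i T ≠ E := by
        rintro h
        obtain ⟨b, hb⟩ := hne
        have hbT : b ∈ insert i T := h ▸ hAE hb
        rcases Finset.mem_insert.1 hbT with rfl | hbT
        · exact hi hb
        · simpa [hb] using hTX hbT
      rw [faceWeight, if_neg (by simp [h8]), Finset.card_insert_of_notMem hiT,
        Finset.card_sdiff_of_subset hA, Finset.card_insert_of_notMem hi]
      have h9 := Finset.card_le_card hTX
      rw [Finset.card_sdiff_of_subset hA, Finset.card_insert_of_notMem hi] at h9
      have h10 := Finset.card_le_card hA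
      rw [Finset.card_insert_of_notMem hi] at h10
      congr 1 <;> omega

lemma linearFunctional_modular (E : Finset α) (x : α → ℤ) :
    linearFunctional E (fun T => ∑ i ∈ T, x i) = 0 := by
  have h : linearFunctional E (fun T => ∑ i ∈ T, x i) =
      linearFunctional E (∑ i ∈ E, x i • simplexFn {i}) := by
    refine linearFunctional_congr fun T hT => ?_
    rw [Finset.sum_apply, ← Finset.sum_subset hT]
    · exact Finset.sum_congr rfl fun i hi => by simp [simplexFn, hi]
    · intro i _ hi; simp [simplexFn, hi]
  rw [h, map_sum]
  refine Finset.sum_eq_zero fun i hi => ?_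
  rw [map_zsmul, linearFunctional_simplexFn (by simpa using hi)]
  simp

lemma linearFunctional_nonneg {E : Finset α} {f : Finset α → ℤ} {x : α → ℤ}
    (hx : x ∈ basePts E f) : 0 ≤ linearFunctional E f := by
  rw [← linearFunctional_modular E x, linearFunctional_apply, linearFunctional_apply, hx.2.2]
  refine sub_le_sub_right (Finset.sum_le_sum fun T hT => ?_) _
  refine mul_le_mul_of_nonneg_left ?_ (faceWeight_nonneg E T)
  exact_mod_cast hx.2.1 T (Finset.mem_powerset.1 hT)

theorem coeff_one_eq_linearFunctional [Fintype α] {E : Finset α} {f : Finset α → ℤ}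
    (hf : Submod f) {p : Polynomial ℝ}
    (hp : ∀ n : ℕ, 0 < n → p.eval (n : ℝ) = (basePts E (n • f)).ncard) :
    p.coeff 1 = linearFunctional E f := by
  obtain ⟨R, hR⟩ := basePoly E (Option (Finset α)) (fun o => o.elim f simplexFn) fun o => by
    cases o with
    | none => exact hf
    | some S => exact submod_simplexFn S
  obtain ⟨L, hL⟩ := exists_linear_coeff_one R
  set φ : (Option (Finset α) → ℕ) → Polynomial ℚ := fun v =>
    MvPolynomial.aeval (fun i => Polynomial.C (v i : ℚ) * Polynomial.X) R with hφ
  have hφc : ∀ v, (φ v).coeff 1 = v none * L none + ∑ S, v (some S) * L (some S) := fun v => by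
    rw [hφ, hL, Fintype.sum_option]
  have hφe : ∀ v (n : ℕ), (φ v).eval (n : ℚ) =
      (basePts E (n • (v none • f + ∑ S, v (some S) • simplexFn S))).ncard := fun v n => by
    have h := hR fun i => n * v i
    push_cast at h
    rw [hφ, eval_aeval_C_mul_X, ← h, Fintype.sum_option, smul_add, Finset.smul_sum]
    simp only [mul_smul]
    rfl
  have hnone : p.coeff 1 = L none := by
    have h : p = (φ fun o => o.elim 1 0).map (algebraMap ℚ ℝ) := by
      refine polynomial_eq_of_eval_nat_eq fun n hn => ?_
      rw [hp n hn, Polynomial.eval_natCast_map, hφe]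
      simp
    rw [h, Polynomial.coeff_map, hφc]
    simp
  have hsome : ∀ S, S ⊆ E → L (some S) = harmonic (S.card - 1) := by
    intro S hS
    have h1 : (φ (Pi.single (some S) 1)).coeff 1 = L (some S) := by
      rw [hφc, Finset.sum_eq_single S]
      · simp
      · intro T _ hT; simp [hT]
      · simp
    have h2 : ∀ n : ℕ, (φ (Pi.single (some S) 1)).eval (n : ℚ) =
        (basePts E (n • simplexFn S)).ncard := fun n => by
      rw [hφe, Finset.sum_eq_single S]
      · simp
      · intro T _ hT; simp [hT]
      · simp
    rcases S.eq_empty_or_nonempty with rfl | hne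
    · have h0 : simplexFn (∅ : Finset α) = 0 := by funext T; simp [simplexFn]
      have h3 : φ (Pi.single (some ∅) 1) =
          Polynomial.C ((basePts E (0 : Finset α → ℤ)).ncard : ℚ) :=
        polynomial_eq_of_eval_nat_eq fun n _ => by rw [h2, h0]; simp
      rw [← h1, h3]
      simp
    · have h3 : φ (Pi.single (some S) 1) = choosePoly (S.card - 1) :=
        polynomial_eq_of_eval_nat_eq fun n _ => by
          rw [h2, eval_choosePoly, ncard_basePts_nsmul_simplexFn hS hne]
      rw [← h1, h3, coeff_one_choosePoly]
  obtain ⟨a, b, hab⟩ := exists_nat_simplexFn_decomp E hf.1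
  have hrestrict : ∀ {M : Type} [AddCommMonoid M] (c : Finset α → ℕ) (g : Finset α → M),
      ∑ S, (if S ⊆ E then c S else 0) • g S = ∑ S ∈ E.powerset, c S • g S := by
    intro M _ c g
    rw [← Finset.sum_subset (Finset.subset_univ E.powerset)]
    · exact Finset.sum_congr rfl fun S hS => by rw [if_pos (Finset.mem_powerset.1 hS)]
    · intro S _ hS
      rw [if_neg (fun h => hS (Finset.mem_powerset.2 h)), zero_smul]
  have hφab : φ (fun o => o.elim 1 fun S => if S ⊆ E then a S else 0) =
      φ (fun o => o.elim 0 fun S => if S ⊆ E then b S else 0) := by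
    refine polynomial_eq_of_eval_nat_eq fun n _ => ?_
    rw [hφe, hφe]
    simp only [Option.elim, hrestrict]
    congr 2
    refine basePts_congr fun T hT => ?_
    rw [Pi.smul_apply, Pi.smul_apply, one_smul, hab T hT, zero_smul, zero_add]
  have h1 := congrArg (fun q => Polynomial.coeff q 1) hφab
  simp only [hφc, Option.elim, ← nsmul_eq_mul, hrestrict] at h1
  have h2 : linearFunctional E (f + ∑ S ∈ E.powerset, a S • simplexFn S) =
      linearFunctional E (∑ S ∈ E.powerset, b S • simplexFn S) := linearFunctional_congr hab
  have h3 : ∀ c : Finset α → ℕ, linearFunctional E (∑ S ∈ E.powerset, c S • simplexFn S) =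
      ∑ S ∈ E.powerset, c S • L (some S) := fun c => by
    rw [map_sum]
    refine Finset.sum_congr rfl fun S hS => ?_
    have hS' := Finset.mem_powerset.1 hS
    rw [map_nsmul, linearFunctional_simplexFn hS', hsome S hS']
  rw [map_add, h3, h3] at h2
  rw [hnone]
  norm_cast
  simp only [one_smul, zero_smul, zero_add] at h1
  linarith

end LinearCoefficient

section Geometry

/-- The strict upper sets of `u`. -/
def IsStrictUpper {ι : Type} (u : ι → ℝ) (T : Finset ι) : Prop :=
  ∀ i ∈ T, ∀ j ∉ T, u j < u i

lemma sum_mul_nonneg_of_isStrictUpper {ι : Type} [Fintype ι] [DecidableEq ι] (u z : ι → ℝ)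
    (h0 : ∑ i, z i = 0) (h : ∀ T, IsStrictUpper u T → 0 ≤ ∑ i ∈ T, z i) :
    0 ≤ ∑ i, u i * z i := by
  induction hn : (Finset.univ.image u).card using Nat.strong_induction_on generalizing u with
  | _ n ih =>
  rcases isEmpty_or_nonempty ι with _ | _
  · simp
  obtain ⟨a, ha, hmin⟩ := Finset.exists_min_image Finset.univ u Finset.univ_nonempty
  set V := Finset.univ.filter fun i => u a < u i with hV
  rcases V.eq_empty_or_nonempty with hVe | hVne
  · have hc : ∀ i, u i = u a := fun i => by
      refine le_antisymm ?_ (hmin i (by simp))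
      by_contra hi
      have : i ∈ V := by simp [hV]; linarith
      simp [hVe] at this
    simp only [hc, ← Finset.mul_sum, h0, mul_zero, le_refl]
  · obtain ⟨b, hb, hbmin⟩ := Finset.exists_min_image V u hVne
    have hab : u a < u b := by simpa [hV] using hb
    set w : ι → ℝ := fun i => max (u i) (u b) with hw
    have hwV : ∀ i, i ∈ V → w i = u i := fun i hi => max_eq_left (hbmin i hi)
    have hua : ∀ i, i ∉ V → u i = u a := fun i hi =>
      le_antisymm (by simpa [hV] using hi) (hmin i (by simp))
    have hwb : ∀ i, i ∉ V → w i = u b := fun i hi => by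
      simp only [hw, hua i hi, max_eq_right hab.le]
    have hsub : Finset.univ.image w ⊂ Finset.univ.image u := by
      refine (Finset.ssubset_iff_of_subset ?_).2 ⟨u a, by simp, ?_⟩
      · intro y hy
        obtain ⟨i, -, rfl⟩ := Finset.mem_image.1 hy
        by_cases hi : i ∈ V
        · rw [hwV i hi]; simp
        · rw [hwb i hi]; simp
      · simp only [Finset.mem_image, Finset.mem_univ, true_and, not_exists]
        intro i hi
        have : u b ≤ w i := le_max_right _ _
        linarith
    have hwz := ih _ (hn ▸ Finset.card_lt_card hsub) w (fun T hT => h T fun i hi j hj => by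
      have h1 := hT i hi j hj
      have h2 : u b ≤ w j := le_max_right _ _
      have h3 : u j ≤ w j := le_max_left _ _
      have h4 : w i = u i := by
        rcases max_choice (u i) (u b) with h5 | h5
        · exact h5
        · have : w i = u b := h5
          linarith
      linarith) rfl
    have hVz : 0 ≤ ∑ i ∈ V, z i := h V fun i hi j hj => by
      rw [hua j hj]; simpa [hV] using hi
    have key : ∑ i, u i * z i = ∑ i, w i * z i + (u b - u a) * ∑ i ∈ V, z i := by
      have h5 : ∀ i, u i * z i = w i * z i - (u b - u a) * z i +
          (u b - u a) * (if i ∈ V then z i else 0) := fun i => by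
        by_cases hi : i ∈ V
        · rw [hwV i hi, if_pos hi]; ring
        · rw [hwb i hi, if_neg hi, hua i hi]; ring
      simp only [h5, Finset.sum_add_distrib, Finset.sum_sub_distrib, ← Finset.mul_sum, h0,
        Finset.sum_ite_mem, Finset.univ_inter]
      ring
    rw [key]
    have := mul_nonneg (sub_nonneg.2 hab.le) hVz
    linarith

variable {d : ℕ}

lemma sum_le_of_mem_permutahedron {T : Finset (Fin d)} {c : ℝ}
    (h : ∀ σ : Equiv.Perm (Fin d), ∑ i ∈ T, (((σ i : ℕ) : ℝ) + 1) ≤ c) {y : Fin d → ℝ}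
    (hy : y ∈ permutahedron d) : ∑ i ∈ T, y i ≤ c := by
  have hconv : Convex ℝ {y : Fin d → ℝ | ∑ i ∈ T, y i ≤ c} := by
    refine convex_halfSpace_le (f := fun y : Fin d → ℝ => ∑ i ∈ T, y i) ⟨?_, ?_⟩ c
    · intro x y; simp [Finset.sum_add_distrib]
    · intro a x; simp [Finset.mul_sum]
  refine convexHull_min ?_ hconv hy
  rintro _ ⟨σ, rfl⟩
  exact h σ

lemma sum_univ_of_mem_permutahedron {y y' : Fin d → ℝ} (hy : y ∈ permutahedron d)
    (hy' : y' ∈ permutahedron d) : ∑ i, y i = ∑ i, y' i := by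
  have hs : ∀ σ : Equiv.Perm (Fin d), ∑ i, (((σ i : ℕ) : ℝ) + 1) = ∑ i : Fin d, ((i : ℝ) + 1) :=
    fun σ => Equiv.sum_comp σ fun i : Fin d => ((i : ℝ) + 1)
  have hc : ∀ y ∈ permutahedron d, ∑ i, y i = ∑ i : Fin d, ((i : ℝ) + 1) := by
    intro y hy
    have hconv : Convex ℝ {y : Fin d → ℝ | ∑ i, y i = ∑ i : Fin d, ((i : ℝ) + 1)} := by
      refine convex_hyperplane (f := fun y : Fin d → ℝ => ∑ i, y i) ⟨?_, ?_⟩ _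
      · intro x y; simp [Finset.sum_add_distrib]
      · intro a x; simp [Finset.mul_sum]
    refine convexHull_min ?_ hconv hy
    rintro _ ⟨σ, rfl⟩
    exact hs σ
  rw [hc y hy, hc y' hy']

lemma exists_mem_permutahedron_forall_sum_le (u : Fin d → ℝ) :
    ∃ y ∈ permutahedron d, ∀ T, IsStrictUpper u T → ∀ y' ∈ permutahedron d,
      ∑ i ∈ T, y' i ≤ ∑ i ∈ T, y i := by
  set r := (Tuple.sort u).symm with hr
  have hmono : Monotone (u ∘ Tuple.sort u) := Tuple.monotone_sort u
  have hlt : ∀ i j, u j < u i → r j < r i := fun i j hij => by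
    by_contra hle
    have := hmono (not_lt.1 hle)
    simp [hr] at this
    linarith
  refine ⟨fun i => ((r i : ℕ) : ℝ) + 1, subset_convexHull ℝ _ ⟨r, rfl⟩, fun T hT y' hy' => ?_⟩
  refine sum_le_of_mem_permutahedron (fun σ => ?_) hy'
  have hmv : Monovary (fun i : Fin d => if i ∈ T then (1 : ℝ) else 0)
      (fun i => ((r i : ℕ) : ℝ) + 1) := by
    intro i j hij
    by_cases hi : i ∈ T <;> by_cases hj : j ∈ T <;> simp [hi, hj]
    have h1 := hlt i j (hT i hi j hj)
    have h2 : r i < r j := by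
      simpa using hij
    exact absurd h2 h1.asymm
  have h := hmv.sum_smul_comp_perm_le_sum_smul (σ := σ.trans r.symm)
  simpa [Finset.sum_ite_mem] using h

variable {P Q : Set (Fin d → ℝ)} {lam : ℝ}

lemma nonempty_of_add_eq_smul_permutahedron (h : P + Q = lam • permutahedron d) : P.Nonempty := by
  have h1 : (permutahedron d).Nonempty := ⟨_, subset_convexHull ℝ _ ⟨1, rfl⟩⟩
  have h2 := h ▸ h1.smul_set (a := lam)
  exact h2.of_add_left

lemma exists_mem_forall_sum_le (hlam : 0 < lam) (h : P + Q = lam • permutahedron d)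
    (u : Fin d → ℝ) :
    ∃ x ∈ P, ∀ T, IsStrictUpper u T → ∀ x' ∈ P, ∑ i ∈ T, x' i ≤ ∑ i ∈ T, x i := by
  obtain ⟨y, hy, hmax⟩ := exists_mem_permutahedron_forall_sum_le u
  obtain ⟨x, hx, q, hq, hxq⟩ := (h ▸ Set.smul_mem_smul_set hy : lam • y ∈ P + Q)
  refine ⟨x, hx, fun T hT x' hx' => ?_⟩
  obtain ⟨y', hy', hxq'⟩ := (h ▸ Set.add_mem_add hx' hq : x' + q ∈ lam • permutahedron d)
  have h1 := mul_le_mul_of_nonneg_left (hmax T hT y' hy') hlam.le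
  have h2 : ∑ i ∈ T, (x i + q i) = lam * ∑ i ∈ T, y i := by
    rw [Finset.mul_sum]; exact Finset.sum_congr rfl fun i _ => congrFun hxq i
  have h3 : lam * ∑ i ∈ T, y' i = ∑ i ∈ T, (x' i + q i) := by
    rw [Finset.mul_sum]; exact Finset.sum_congr rfl fun i _ => congrFun hxq' i
  rw [Finset.sum_add_distrib] at h2 h3
  linarith

lemma sum_univ_eq_of_mem (h : P + Q = lam • permutahedron d) {x x' : Fin d → ℝ} (hx : x ∈ P)
    (hx' : x' ∈ P) : ∑ i, x i = ∑ i, x' i := by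
  have hne : Q.Nonempty :=
    (nonempty_of_add_eq_smul_permutahedron ((add_comm Q P).trans h))
  obtain ⟨q, hq⟩ := hne
  obtain ⟨y, hy, hxq⟩ := (h ▸ Set.add_mem_add hx hq : x + q ∈ lam • permutahedron d)
  obtain ⟨y', hy', hxq'⟩ := (h ▸ Set.add_mem_add hx' hq : x' + q ∈ lam • permutahedron d)
  have h1 := sum_univ_of_mem_permutahedron hy hy'
  have h2 : lam * ∑ i, y i = ∑ i, (x i + q i) := by
    rw [Finset.mul_sum]; exact Finset.sum_congr rfl fun i _ => congrFun hxq i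
  have h3 : lam * ∑ i, y' i = ∑ i, (x' i + q i) := by
    rw [Finset.mul_sum]; exact Finset.sum_congr rfl fun i _ => congrFun hxq' i
  rw [Finset.sum_add_distrib] at h2 h3
  rw [h1] at h2
  linarith

/-- A support function of `P` on indicator vectors. -/
def IsSupportFn (P : Set (Fin d → ℝ)) (f : Finset (Fin d) → ℤ) : Prop :=
  (∀ T, ∀ x ∈ P, ∑ i ∈ T, x i ≤ f T) ∧ ∀ T, ∃ x ∈ P, ∑ i ∈ T, x i = f T

lemma exists_isSupportFn {S : Finset (Fin d → ℝ)} (hS : (S : Set (Fin d → ℝ)) ⊆ latticePts d)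
    (hne : S.Nonempty) : ∃ f, IsSupportFn (convexHull ℝ (S : Set (Fin d → ℝ))) f := by
  have h : ∀ T : Finset (Fin d), ∃ m : ℤ,
      (∀ x ∈ convexHull ℝ (S : Set (Fin d → ℝ)), ∑ i ∈ T, x i ≤ m) ∧
      ∃ x ∈ convexHull ℝ (S : Set (Fin d → ℝ)), ∑ i ∈ T, x i = m := fun T => by
    obtain ⟨v, hv, hmax⟩ := S.exists_max_image (fun x => ∑ i ∈ T, x i) hne
    choose m hm using hS hv
    have hsum : ∑ i ∈ T, v i = ((∑ i ∈ T, m i : ℤ) : ℝ) := by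
      push_cast; exact Finset.sum_congr rfl fun i _ => hm i
    refine ⟨∑ i ∈ T, m i, fun x hx => ?_, v, subset_convexHull ℝ _ hv, hsum⟩
    have hconv : Convex ℝ {y : Fin d → ℝ | ∑ i ∈ T, y i ≤ ((∑ i ∈ T, m i : ℤ) : ℝ)} := by
      refine convex_halfSpace_le (f := fun y : Fin d → ℝ => ∑ i ∈ T, y i) ⟨?_, ?_⟩ _
      · intro x y; simp [Finset.sum_add_distrib]
      · intro a x; simp [Finset.mul_sum]
    exact convexHull_min (fun x hx => (hmax x hx).trans hsum.le) hconv hx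
  choose f h1 h2 using h
  exact ⟨f, h1, h2⟩

lemma IsSupportFn.submod {f : Finset (Fin d) → ℤ} (hf : IsSupportFn P f) (hlam : 0 < lam)
    (h : P + Q = lam • permutahedron d) : Submod f := by
  refine ⟨?_, fun A B => ?_⟩
  · obtain ⟨x, -, hx⟩ := hf.2 ∅
    have : (f ∅ : ℝ) = 0 := by simpa using hx.symm
    exact_mod_cast this
  · obtain ⟨x, hx, hmax⟩ := exists_mem_forall_sum_le hlam h
      fun i => (if i ∈ A then 1 else 0) + if i ∈ B then 1 else 0
    have hle : ∀ T, IsStrictUpper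
        (fun i => (if i ∈ A then (1 : ℝ) else 0) + if i ∈ B then 1 else 0) T →
        (f T : ℝ) ≤ ∑ i ∈ T, x i := fun T hT => by
      obtain ⟨x', hx', h'⟩ := hf.2 T
      exact h' ▸ hmax T hT x' hx'
    have hu := hle (A ∪ B) fun i hi j hj => by
      simp only [Finset.mem_union, not_or] at hi hj
      by_cases h1 : i ∈ A <;> by_cases h2 : i ∈ B <;> simp_all
    have hi := hle (A ∩ B) fun i hi j hj => by
      simp only [Finset.mem_inter, not_and_or] at hi hj
      by_cases h1 : j ∈ A <;> by_cases h2 : j ∈ B <;> simp_all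
    have hA := hf.1 A x hx
    have hB := hf.1 B x hx
    have := Finset.sum_union_inter (s₁ := A) (s₂ := B) (f := x)
    have hgoal : (f (A ∪ B) : ℝ) + f (A ∩ B) ≤ f A + f B := by linarith
    exact_mod_cast hgoal

lemma IsSupportFn.mem_iff {f : Finset (Fin d) → ℤ} (hf : IsSupportFn P f) (hlam : 0 < lam)
    (h : P + Q = lam • permutahedron d) (hconv : Convex ℝ P) (hclosed : IsClosed P)
    (x : Fin d → ℝ) : x ∈ P ↔ (∀ T, ∑ i ∈ T, x i ≤ f T) ∧ ∑ i, x i = f Finset.univ := by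
  constructor
  · intro hx
    obtain ⟨x', hx', h'⟩ := hf.2 Finset.univ
    exact ⟨fun T => hf.1 T x hx, (sum_univ_eq_of_mem h hx hx').trans h'⟩
  · rintro ⟨h1, h2⟩
    by_contra hx
    obtain ⟨φ, c, hφ, hc⟩ := geometric_hahn_banach_closed_point hconv hclosed hx
    set u : Fin d → ℝ := fun i => φ (Pi.single i 1) with hu
    have hφu : ∀ y, φ y = ∑ i, u i * y i := fun y => by
      conv_lhs => rw [pi_eq_sum_univ' y]
      simp [hu, mul_comm]
    obtain ⟨x', hx', hmax⟩ := exists_mem_forall_sum_le hlam h u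
    obtain ⟨x₀, hx₀, h₀⟩ := hf.2 Finset.univ
    have hz := sum_mul_nonneg_of_isStrictUpper u (x' - x) (by
      simp only [Pi.sub_apply, Finset.sum_sub_distrib, h2, ← h₀, sum_univ_eq_of_mem h hx' hx₀,
        sub_self]) fun T hT => by
      obtain ⟨x₁, hx₁, h₁⟩ := hf.2 T
      have := hmax T hT x₁ hx₁
      have := h1 T
      simp only [Pi.sub_apply, Finset.sum_sub_distrib]
      linarith
    rw [← hφu, map_sub] at hz
    have := hφ x' hx'
    linarith

lemma ncard_smul_inter_latticePts_s10 {f : Finset (Fin d) → ℤ}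
    (hmem : ∀ x, x ∈ P ↔ (∀ T, ∑ i ∈ T, x i ≤ (f T : ℝ)) ∧ ∑ i, x i = (f Finset.univ : ℝ))
    {n : ℕ} (hn : 0 < n) :
    (((n : ℝ) • P) ∩ latticePts d).ncard = (basePts Finset.univ (n • f)).ncard := by
  have hn' : (0 : ℝ) < n := by exact_mod_cast hn
  have hcast : ∀ x : Fin d → ℤ, (fun i => (x i : ℝ)) ∈ (n : ℝ) • P ↔
      x ∈ basePts Finset.univ (n • f) := fun x => by
    rw [Set.mem_smul_set_iff_inv_smul_mem₀ hn'.ne', hmem]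
    simp only [basePts, Set.mem_ofPred_eq, Pi.smul_apply, smul_eq_mul, ← Finset.mul_sum,
      inv_mul_le_iff₀ hn', inv_mul_eq_iff_eq_mul₀ hn'.ne', Finset.mem_univ, not_true_eq_false,
      false_imp_iff, implies_true, true_and, Finset.subset_univ, forall_const, nsmul_eq_mul]
    norm_cast
  symm
  refine Set.ncard_congr (fun x _ i => (x i : ℝ)) ?_ ?_ ?_
  · exact fun x hx => ⟨(hcast x).2 hx, fun i => ⟨x i, rfl⟩⟩
  · intro x y _ _ hxy
    ext i
    exact_mod_cast congrFun hxy i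
  · rintro y ⟨hy, hy'⟩
    choose x hx using hy'
    obtain rfl : y = fun i => (x i : ℝ) := funext hx
    exact ⟨x, (hcast x).1 hy, rfl⟩

end Geometry

theorem stmt10 (d : ℕ) (P : Set (Fin d → ℝ)) (hP : IsGenPerm P)
    (hlat : ∃ S : Finset (Fin d → ℝ), (S : Set (Fin d → ℝ)) ⊆ latticePts d ∧
      P = convexHull ℝ (S : Set (Fin d → ℝ)))
    (p : Polynomial ℝ)
    (hp : ∀ n : ℕ, 0 < n → p.eval (n : ℝ) = ((((n : ℝ) • P) ∩ latticePts d).ncard : ℝ)) :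
    0 ≤ p.coeff 1 := by
  obtain ⟨-, lam, hlam, Q, -, h⟩ := hP
  obtain ⟨S, hS, rfl⟩ := hlat
  have hne : S.Nonempty := by simpa using nonempty_of_add_eq_smul_permutahedron h
  obtain ⟨f, hf⟩ := exists_isSupportFn hS hne
  have hmem := hf.mem_iff hlam h (convex_convexHull ℝ _)
    (S.finite_toSet.isCompact_convexHull (𝕜 := ℝ)).isClosed
  have hcoeff := coeff_one_eq_linearFunctional (hf.submod hlam h) (E := Finset.univ) fun n hn => by
    rw [hp n hn, ncard_smul_inter_latticePts_s10 hmem hn]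
  obtain ⟨v, hv⟩ := hne
  choose x hx using hS hv
  have hvx := (hmem v).1 (subset_convexHull ℝ _ hv)
  simp only [hx] at hvx
  rw [hcoeff]
  exact_mod_cast linearFunctional_nonneg (x := x)
    ⟨by simp, fun T _ => by exact_mod_cast hvx.1 T, by exact_mod_cast hvx.2⟩
end
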